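/- (Vanilla Landing convergence in the deterministic scenario) Let ε ∈ (0, 3/4), λ > 0, L, L', L_m > 0, and let f : ℝ^{n×p} → ℝ be twice continuously differentiable such that for every X ∈ St(p,n)^ε: ‖∇f(X)‖_F ≤ L' and the Hessian of f at X has operator norm at most L (with respect to the Frobenius norm). Let L̂ := max{L, L'} and fix μ ≥ (2/(3−4ε))·( L(1−ε) + 3√(1+ε)·L' + 2L̂²(1+ε)/λ ). Assume the merit function m(X) := f(X) − (1/2)⟨sym(Xᵀ∇f(X)), XᵀX − I_p⟩ + μN(X) has L_m-Lipschitz gradient on ℝ^{n×p} and satisfies m(X) ≥ m* for all X ∈ St(p,n)^ε. Let γ_s := min{ λ(1−ε)ε / ((1+ε)²(L')² + λ²(1+ε)ε²), √(ε / (2(1+ε)²(L')²)), 1/(2λ) } and choose 0 < γ ≤ min{ γ_s, 1/(2L_m), μ/(4λ²(1+ε)L_m) }. Starting from X⁰ ∈ St(p,n)^ε, define X^{k+1} := X^k − γΛ̃(X^k; ∇f(X^k)). Then all iterates stay in St(p,n)^ε and for every K ≥ 1: (1/K)·Σ_{k=0}^{K−1} ‖grad f(X^k)‖_F² ≤ 4(m(X⁰)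 − m*)/(Kγ) and (1/K)·Σ_{k=0}^{K−1} N(X^k) ≤ 2(m(X⁰) − m*)/(Kγλμ). -/

import Mathlib

open Matrix Finset

noncomputable section

/-- Frobenius inner product `⟨A, B⟩ = Tr (Aᵀ * B)`. -/
def finner {n p : ℕ} (A B : Matrix (Fin n) (Fin p) ℝ) : ℝ :=
  (Aᵀ * B).trace

/-- Frobenius norm `‖A‖_F = √(Tr (Aᵀ * A))`. -/
def fnorm {n p : ℕ} (A : Matrix (Fin n) (Fin p) ℝ) : ℝ :=
  Real.sqrt ((Aᵀ * A).trace)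

/-- Skew-symmetric part `skew M = (M - Mᵀ)/2`. -/
def skewPart {m : ℕ} (M : Matrix (Fin m) (Fin m) ℝ) : Matrix (Fin m) (Fin m) ℝ :=
  (1 / 2 : ℝ) • (M - Mᵀ)

/-- Symmetric part `sym M = (M + Mᵀ)/2`. -/
def symPart {m : ℕ} (M : Matrix (Fin m) (Fin m) ℝ) : Matrix (Fin m) (Fin m) ℝ :=
  (1 / 2 : ℝ) • (M + Mᵀ)

/-- Penalty function `N(X) = ‖XᵀX - I‖_F² / 4`. -/
def penaltyN {n p : ℕ} (X : Matrix (Fin n) (Fin p) ℝ) : ℝ :=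
  (1 / 4 : ℝ) * fnorm (Xᵀ * X - 1) ^ 2

/-- Landing direction `Λ̃(X; g) = skew(g Xᵀ) X + λ X (XᵀX - I)` with gradient estimate `g`. -/
def landingDir {n p : ℕ} (lam : ℝ) (X g : Matrix (Fin n) (Fin p) ℝ) :
    Matrix (Fin n) (Fin p) ℝ :=
  skewPart (g * Xᵀ) * X + lam • (X * (Xᵀ * X - 1))

attribute [local instance] Matrix.frobeniusNormedAddCommGroup Matrix.frobeniusNormedSpace

lemma finner_eq_sum {n p : ℕ} (A B : Matrix (Fin n) (Fin p) ℝ) :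
    finner A B = ∑ i, ∑ j, A i j * B i j := by
  simp only [finner, Matrix.trace, Matrix.diag_apply, Matrix.mul_apply, Matrix.transpose_apply]
  exact Finset.sum_comm

lemma finner_comm {n p : ℕ} (A B : Matrix (Fin n) (Fin p) ℝ) : finner A B = finner B A := by
  simp only [finner_eq_sum, mul_comm]

lemma finner_add_left {n p : ℕ} (A B C : Matrix (Fin n) (Fin p) ℝ) :
    finner (A + B) C = finner A C + finner B C := by
  simp [finner, Matrix.add_mul]

lemma finner_add_right {n p : ℕ} (A B C : Matrix (Fin n) (Fin p) ℝ) :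
    finner A (B + C) = finner A B + finner A C := by
  simp [finner, Matrix.mul_add]

lemma finner_sub_left {n p : ℕ} (A B C : Matrix (Fin n) (Fin p) ℝ) :
    finner (A - B) C = finner A C - finner B C := by
  simp [finner, Matrix.sub_mul]

lemma finner_sub_right {n p : ℕ} (A B C : Matrix (Fin n) (Fin p) ℝ) :
    finner A (B - C) = finner A B - finner A C := by
  simp [finner, Matrix.mul_sub]

lemma finner_smul_left {n p : ℕ} (c : ℝ) (A B : Matrix (Fin n) (Fin p) ℝ) :
    finner (c • A) B = c * finner A B := by
  simp [finner]

lemma finner_smul_right {n p : ℕ} (c : ℝ) (A B : Matrix (Fin n) (Fin p) ℝ) :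
    finner A (c • B) = c * finner A B := by
  simp [finner]

lemma finner_neg_right {n p : ℕ} (A B : Matrix (Fin n) (Fin p) ℝ) :
    finner A (-B) = -finner A B := by
  simp [finner]

lemma finner_transpose {n p : ℕ} (A B : Matrix (Fin n) (Fin p) ℝ) :
    finner Aᵀ Bᵀ = finner A B := by
  simp only [finner_eq_sum, Matrix.transpose_apply]
  exact Finset.sum_comm

lemma finner_mul_right_left {n p k : ℕ} (A : Matrix (Fin n) (Fin p) ℝ)
    (X : Matrix (Fin n) (Fin k) ℝ) (M : Matrix (Fin k) (Fin p) ℝ) :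
    finner A (X * M) = finner (Xᵀ * A) M := by
  simp [finner, Matrix.mul_assoc]

lemma finner_mul_right_right {n p k : ℕ} (A : Matrix (Fin n) (Fin p) ℝ)
    (M : Matrix (Fin n) (Fin k) ℝ) (X : Matrix (Fin k) (Fin p) ℝ) :
    finner A (M * X) = finner (A * Xᵀ) M := by
  rw [← finner_transpose, Matrix.transpose_mul, finner_mul_right_left, ← finner_transpose]
  simp [Matrix.transpose_mul]

lemma finner_skew_symm {p : ℕ} {S W : Matrix (Fin p) (Fin p) ℝ} (hS : Sᵀ = S) (hW : Wᵀ = -W) :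
    finner S W = 0 := by
  have h := finner_transpose S W
  rw [hS, hW, finner_neg_right] at h
  linarith

lemma finner_self_nonneg {n p : ℕ} (A : Matrix (Fin n) (Fin p) ℝ) : 0 ≤ finner A A := by
  rw [finner_eq_sum]
  exact Finset.sum_nonneg fun i _ => Finset.sum_nonneg fun j _ => mul_self_nonneg _

lemma fnorm_sq {n p : ℕ} (A : Matrix (Fin n) (Fin p) ℝ) : fnorm A ^ 2 = finner A A :=
  Real.sq_sqrt (finner_self_nonneg A)

lemma fnorm_nonneg {n p : ℕ} (A : Matrix (Fin n) (Fin p) ℝ) : 0 ≤ fnorm A :=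
  Real.sqrt_nonneg _

lemma fnorm_eq_norm {n p : ℕ} (A : Matrix (Fin n) (Fin p) ℝ) : fnorm A = ‖A‖ := by
  rw [Matrix.frobenius_norm_def, ← Real.sqrt_eq_rpow]
  change Real.sqrt (finner A A) = _
  simp [finner_eq_sum, sq]

lemma fnorm_add_le {n p : ℕ} (A B : Matrix (Fin n) (Fin p) ℝ) :
    fnorm (A + B) ≤ fnorm A + fnorm B := by
  simpa only [fnorm_eq_norm] using norm_add_le A B

lemma fnorm_sub_le {n p : ℕ} (A B : Matrix (Fin n) (Fin p) ℝ) :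
    fnorm (A - B) ≤ fnorm A + fnorm B := by
  simpa only [fnorm_eq_norm] using norm_sub_le A B

lemma fnorm_smul {n p : ℕ} (c : ℝ) (A : Matrix (Fin n) (Fin p) ℝ) :
    fnorm (c • A) = |c| * fnorm A := by
  simpa only [fnorm_eq_norm, Real.norm_eq_abs] using norm_smul c A

lemma fnorm_neg {n p : ℕ} (A : Matrix (Fin n) (Fin p) ℝ) : fnorm (-A) = fnorm A := by
  simp [fnorm]

lemma fnorm_mul_le {n p k : ℕ} (A : Matrix (Fin n) (Fin k) ℝ) (B : Matrix (Fin k) (Fin p) ℝ) :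
    fnorm (A * B) ≤ fnorm A * fnorm B := by
  simpa only [fnorm_eq_norm] using Matrix.frobenius_norm_mul A B

lemma fnorm_transpose {n p : ℕ} (A : Matrix (Fin n) (Fin p) ℝ) : fnorm Aᵀ = fnorm A := by
  have h := finner_transpose A A
  rw [← fnorm_sq, ← fnorm_sq] at h
  exact (pow_left_inj₀ (fnorm_nonneg _) (fnorm_nonneg _) two_ne_zero).1 h

lemma abs_finner_le {n p : ℕ} (A B : Matrix (Fin n) (Fin p) ℝ) :
    |finner A B| ≤ fnorm A * fnorm B := by
  refine abs_le_of_sq_le_sq ?_ (mul_nonneg (fnorm_nonneg _) (fnorm_nonneg _))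
  rw [mul_pow, fnorm_sq, fnorm_sq]
  simp only [finner_eq_sum, ← Finset.sum_product', ← sq]
  exact Finset.sum_mul_sq_le_sq_mul_sq _ _ _

lemma finner_le {n p : ℕ} (A B : Matrix (Fin n) (Fin p) ℝ) :
    finner A B ≤ fnorm A * fnorm B :=
  (le_abs_self _).trans (abs_finner_le A B)

lemma fnorm_add_sq {n p : ℕ} (A B : Matrix (Fin n) (Fin p) ℝ) :
    fnorm (A + B) ^ 2 = fnorm A ^ 2 + 2 * finner A B + fnorm B ^ 2 := by
  simp only [fnorm_sq, finner_add_left, finner_add_right, finner_comm B A]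
  ring

/-- The matrix `U * diag(v) * Uᵀ`. -/
def spectralMat {p : ℕ} (U : Matrix (Fin p) (Fin p) ℝ) (v : Fin p → ℝ) :
    Matrix (Fin p) (Fin p) ℝ :=
  U * Matrix.diagonal v * Uᵀ

lemma exists_spectralMat {p : ℕ} {S : Matrix (Fin p) (Fin p) ℝ} (hS : Sᵀ = S) :
    ∃ (U : Matrix (Fin p) (Fin p) ℝ) (v : Fin p → ℝ), U * Uᵀ = 1 ∧ Uᵀ * U = 1 ∧
      S = spectralMat U v := by
  have hH : S.IsHermitian := by
    rw [Matrix.IsHermitian, Matrix.conjTranspose_eq_transpose_of_trivial]; exact hS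
  have hU := hH.eigenvectorUnitary.2
  have h1 := (Matrix.mem_unitaryGroup_iff).1 hU
  have h2 := (Matrix.mem_unitaryGroup_iff').1 hU
  rw [Matrix.star_eq_conjTranspose, Matrix.conjTranspose_eq_transpose_of_trivial] at h1 h2
  refine ⟨hH.eigenvectorUnitary, hH.eigenvalues, h1, h2, ?_⟩
  have h := hH.spectral_theorem
  simpa [spectralMat, Matrix.star_eq_conjTranspose, Unitary.conjStarAlgAut_apply,
    Function.comp_def] using h

section spectral

variable {p : ℕ} {U : Matrix (Fin p) (Fin p) ℝ}

lemma spectralMat_mul (hU : Uᵀ * U = 1) (v w : Fin p → ℝ) :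
    spectralMat U v * spectralMat U w = spectralMat U (v * w) := by
  have : spectralMat U v * spectralMat U w =
      U * Matrix.diagonal v * (Uᵀ * U) * Matrix.diagonal w * Uᵀ := by
    simp only [spectralMat, Matrix.mul_assoc]
  rw [this, hU, Matrix.mul_one, Matrix.mul_assoc U, Matrix.diagonal_mul_diagonal]
  rfl

lemma spectralMat_add (v w : Fin p → ℝ) :
    spectralMat U v + spectralMat U w = spectralMat U (v + w) := by
  simp only [spectralMat, ← Matrix.add_mul, ← Matrix.mul_add, Matrix.diagonal_add]
  rfl

lemma spectralMat_sub (v w : Fin p → ℝ) :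
    spectralMat U v - spectralMat U w = spectralMat U (v - w) := by
  simp only [spectralMat, ← Matrix.sub_mul, ← Matrix.mul_sub, Matrix.diagonal_sub]
  rfl

lemma spectralMat_smul (c : ℝ) (v : Fin p → ℝ) :
    c • spectralMat U v = spectralMat U (c • v) := by
  simp only [spectralMat, Matrix.diagonal_smul, Matrix.mul_smul, Matrix.smul_mul]

lemma spectralMat_one (hU : U * Uᵀ = 1) : spectralMat U 1 = 1 := by
  have h : Matrix.diagonal (1 : Fin p → ℝ) = 1 := Matrix.diagonal_one
  rw [spectralMat, h, Matrix.mul_one, hU]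

lemma spectralMat_transpose (v : Fin p → ℝ) : (spectralMat U v)ᵀ = spectralMat U v := by
  simp [spectralMat, Matrix.mul_assoc]

lemma trace_spectralMat (hU : Uᵀ * U = 1) (v : Fin p → ℝ) :
    (spectralMat U v).trace = ∑ i, v i := by
  rw [spectralMat, Matrix.trace_mul_comm, ← Matrix.mul_assoc, hU, Matrix.one_mul,
    Matrix.trace_diagonal]

lemma fnorm_spectralMat_sq (hU : Uᵀ * U = 1) (v : Fin p → ℝ) :
    fnorm (spectralMat U v) ^ 2 = ∑ i, v i ^ 2 := by
  rw [fnorm_sq, finner, spectralMat_transpose, spectralMat_mul hU, trace_spectralMat hU]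
  simp [sq]

lemma fnorm_mul_spectralMat_sq {n : ℕ} {X : Matrix (Fin n) (Fin p) ℝ} {d : Fin p → ℝ}
    (hU : U * Uᵀ = 1) (hU' : Uᵀ * U = 1) (hX : Xᵀ * X - 1 = spectralMat U d) (v : Fin p → ℝ) :
    fnorm (X * spectralMat U v) ^ 2 = ∑ i, v i ^ 2 * (1 + d i) := by
  have hXX : Xᵀ * X = spectralMat U (1 + d) := by
    rw [← spectralMat_add, ← hX, spectralMat_one hU]; abel
  have : fnorm (X * spectralMat U v) ^ 2 =
      (spectralMat U v * (Xᵀ * X) * spectralMat U v).trace := by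
    rw [fnorm_sq, finner, Matrix.transpose_mul, spectralMat_transpose]
    simp only [Matrix.mul_assoc]
  rw [this, hXX, spectralMat_mul hU', spectralMat_mul hU', trace_spectralMat hU']
  refine Finset.sum_congr rfl fun i _ => ?_
  simp only [Pi.mul_apply, Pi.add_apply, Pi.one_apply]
  ring

end spectral

lemma fnorm_mul_sq_le {n p k : ℕ} {X : Matrix (Fin n) (Fin p) ℝ} {ε : ℝ}
    (hX : fnorm (Xᵀ * X - 1) ≤ ε) (M : Matrix (Fin p) (Fin k) ℝ) :
    fnorm (X * M) ^ 2 ≤ (1 + ε) * fnorm M ^ 2 := by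
  have h1 : fnorm (X * M) ^ 2 = fnorm M ^ 2 + finner M ((Xᵀ * X - 1) * M) := by
    rw [fnorm_sq, fnorm_sq, finner_mul_right_left, Matrix.sub_mul, Matrix.one_mul,
      finner_sub_right, finner_comm _ M, Matrix.mul_assoc]
    ring
  have h2 := finner_le M ((Xᵀ * X - 1) * M)
  have h3 := (fnorm_mul_le (Xᵀ * X - 1) M).trans
    (mul_le_mul_of_nonneg_right hX (fnorm_nonneg M))
  nlinarith [mul_le_mul_of_nonneg_left h3 (fnorm_nonneg M)]

lemma fnorm_mul_le_sqrt {n p k : ℕ} {X : Matrix (Fin n) (Fin p) ℝ} {ε : ℝ}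
    (hX : fnorm (Xᵀ * X - 1) ≤ ε) (M : Matrix (Fin p) (Fin k) ℝ) :
    fnorm (X * M) ≤ Real.sqrt (1 + ε) * fnorm M := by
  have hε : 0 ≤ ε := (fnorm_nonneg _).trans hX
  refine (sq_le_sq₀ (fnorm_nonneg _) (mul_nonneg (Real.sqrt_nonneg _) (fnorm_nonneg _))).1 ?_
  rw [mul_pow, Real.sq_sqrt (by linarith)]
  exact fnorm_mul_sq_le hX M

lemma fnorm_transpose_mul_le_sqrt {n p k : ℕ} {X : Matrix (Fin n) (Fin p) ℝ} {ε : ℝ}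
    (hX : fnorm (Xᵀ * X - 1) ≤ ε) (M : Matrix (Fin n) (Fin k) ℝ) :
    fnorm (Xᵀ * M) ≤ Real.sqrt (1 + ε) * fnorm M := by
  have h1 : fnorm (Xᵀ * M) ^ 2 = finner M (X * (Xᵀ * M)) := by
    rw [fnorm_sq, finner_mul_right_left, Matrix.transpose_transpose, finner_comm]
  have h2 := finner_le M (X * (Xᵀ * M))
  have h3 := mul_le_mul_of_nonneg_left (fnorm_mul_le_sqrt hX (Xᵀ * M)) (fnorm_nonneg M)
  rcases (fnorm_nonneg (Xᵀ * M)).eq_or_lt with h | h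
  · rw [← h]; exact mul_nonneg (Real.sqrt_nonneg _) (fnorm_nonneg _)
  · refine le_of_mul_le_mul_right ?_ h
    nlinarith

lemma isBoundedBilinearMap_finner {n p : ℕ} :
    IsBoundedBilinearMap ℝ
      fun x : Matrix (Fin n) (Fin p) ℝ × Matrix (Fin n) (Fin p) ℝ => finner x.1 x.2 where
  add_left := finner_add_left
  smul_left := finner_smul_left
  add_right := finner_add_right
  smul_right := finner_smul_right
  bound := ⟨1, one_pos, fun A B => by
    simpa [← fnorm_eq_norm] using abs_finner_le A B⟩

lemma isBoundedBilinearMap_matrix_mul {n p k : ℕ} :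
    IsBoundedBilinearMap ℝ
      fun x : Matrix (Fin n) (Fin k) ℝ × Matrix (Fin k) (Fin p) ℝ => x.1 * x.2 where
  add_left := Matrix.add_mul
  smul_left := fun c A B => Matrix.smul_mul c A B
  add_right := Matrix.mul_add
  smul_right := fun c A B => Matrix.mul_smul A c B
  bound := ⟨1, one_pos, fun A B => by simpa using Matrix.frobenius_norm_mul A B⟩

lemma HasDerivAt.finner {n p : ℕ} {c e : ℝ → Matrix (Fin n) (Fin p) ℝ}
    {c' e' : Matrix (Fin n) (Fin p) ℝ} {t : ℝ} (hc : HasDerivAt c c' t)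
    (he : HasDerivAt e e' t) :
    HasDerivAt (fun s => finner (c s) (e s)) (finner (c t) e' + finner c' (e t)) t := by
  have h := isBoundedBilinearMap_finner.hasFDerivAt (𝕜 := ℝ) (c t, e t)
  exact h.comp_hasDerivAt (f := fun s => (c s, e s)) t (hc.prodMk he)

lemma HasDerivAt.matrixMul {n p k : ℕ} {c : ℝ → Matrix (Fin n) (Fin k) ℝ}
    {e : ℝ → Matrix (Fin k) (Fin p) ℝ} {c' : Matrix (Fin n) (Fin k) ℝ}
    {e' : Matrix (Fin k) (Fin p) ℝ} {t : ℝ} (hc : HasDerivAt c c' t) (he : HasDerivAt e e' t) :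
    HasDerivAt (fun s => c s * e s) (c t * e' + c' * e t) t := by
  have h := isBoundedBilinearMap_matrix_mul.hasFDerivAt (𝕜 := ℝ) (c t, e t)
  exact h.comp_hasDerivAt (f := fun s => (c s, e s)) t (hc.prodMk he)

lemma hasDerivAt_line {n p : ℕ} (Y H : Matrix (Fin n) (Fin p) ℝ) (t : ℝ) :
    HasDerivAt (fun s : ℝ => Y + s • H) H t := by
  have h := ((hasDerivAt_id t).smul_const H).const_add Y
  rw [one_smul] at h
  exact h

lemma hasDerivAt_comp_line {n p : ℕ} {g : Matrix (Fin n) (Fin p) ℝ → ℝ}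
    {grad : Matrix (Fin n) (Fin p) ℝ → Matrix (Fin n) (Fin p) ℝ} (hg : Differentiable ℝ g)
    (hgrad : ∀ Y H : Matrix (Fin n) (Fin p) ℝ, fderiv ℝ g Y H = finner (grad Y) H)
    (Y H : Matrix (Fin n) (Fin p) ℝ) (t : ℝ) :
    HasDerivAt (fun s : ℝ => g (Y + s • H)) (finner (grad (Y + t • H)) H) t := by
  rw [← hgrad]
  exact (hg (Y + t • H)).hasFDerivAt.comp_hasDerivAt t (hasDerivAt_line Y H t)

lemma differentiable_of_fderiv_eq_finner {n p : ℕ} {f : Matrix (Fin n) (Fin p) ℝ → ℝ}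
    {gradf : Matrix (Fin n) (Fin p) ℝ → Matrix (Fin n) (Fin p) ℝ} (hC2 : ContDiff ℝ 2 f)
    (hgrad : ∀ Y H : Matrix (Fin n) (Fin p) ℝ, fderiv ℝ f Y H = finner (gradf Y) H) :
    Differentiable ℝ gradf := by
  have h1 : Differentiable ℝ (fderiv ℝ f) :=
    (hC2.fderiv_right (m := 1) (by norm_num)).differentiable one_ne_zero
  have h2 : gradf = fun Y => ∑ i, ∑ j,
      (fderiv ℝ f Y (Matrix.single i j 1)) • (Matrix.single i j (1 : ℝ)) := by
    funext Y
    conv_lhs => rw [Matrix.matrix_eq_sum_single (gradf Y)]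
    refine Finset.sum_congr rfl fun i _ => Finset.sum_congr rfl fun j _ => ?_
    rw [hgrad, Matrix.smul_single]
    congr 1
    simp [finner_eq_sum, Matrix.single_apply, ite_and, Finset.sum_ite_eq]
  rw [h2]
  fun_prop

/-- The standing assumptions relating `f`, the merit function `m` and their gradients. -/
structure IsLandingMerit {n p : ℕ} (ε L L' Lm μ : ℝ) (f : Matrix (Fin n) (Fin p) ℝ → ℝ)
    (gradf : Matrix (Fin n) (Fin p) ℝ → Matrix (Fin n) (Fin p) ℝ)
    (m : Matrix (Fin n) (Fin p) ℝ → ℝ)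
    (gradm : Matrix (Fin n) (Fin p) ℝ → Matrix (Fin n) (Fin p) ℝ) : Prop where
  diff_f : Differentiable ℝ f
  diff_gradf : Differentiable ℝ gradf
  fderiv_f : ∀ Y H : Matrix (Fin n) (Fin p) ℝ, fderiv ℝ f Y H = finner (gradf Y) H
  gradf_le : ∀ X : Matrix (Fin n) (Fin p) ℝ, fnorm (Xᵀ * X - 1) ≤ ε → fnorm (gradf X) ≤ L'
  hess_le : ∀ X : Matrix (Fin n) (Fin p) ℝ, fnorm (Xᵀ * X - 1) ≤ ε →
    ∀ H : Matrix (Fin n) (Fin p) ℝ, fnorm (fderiv ℝ gradf X H) ≤ L * fnorm H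
  merit_eq : ∀ Y : Matrix (Fin n) (Fin p) ℝ, m Y = f Y -
    (1 / 2) * finner (gradf Y) (Y * (Yᵀ * Y - 1)) + μ * penaltyN Y
  diff_m : Differentiable ℝ m
  fderiv_m : ∀ Y H : Matrix (Fin n) (Fin p) ℝ, fderiv ℝ m Y H = finner (gradm Y) H
  gradm_lip : ∀ Y Z : Matrix (Fin n) (Fin p) ℝ,
    fnorm (gradm Y - gradm Z) ≤ Lm * fnorm (Y - Z)

lemma penaltyN_eq_finner {n p : ℕ} (Y : Matrix (Fin n) (Fin p) ℝ) :
    penaltyN Y = (1 / 4 : ℝ) * finner (Yᵀ * Y - 1) (Yᵀ * Y - 1) := by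
  rw [penaltyN, fnorm_sq]

lemma gram_sub_one_transpose {n p : ℕ} (Y : Matrix (Fin n) (Fin p) ℝ) :
    (Yᵀ * Y - 1)ᵀ = Yᵀ * Y - 1 := by
  simp [Matrix.transpose_mul]

lemma finner_symPart {p : ℕ} (M : Matrix (Fin p) (Fin p) ℝ) {S : Matrix (Fin p) (Fin p) ℝ}
    (hS : Sᵀ = S) : finner (symPart M) S = finner M S := by
  have h := finner_transpose M S
  rw [hS] at h
  rw [symPart, finner_smul_left, finner_add_left, h]
  ring

section merit

variable {n p : ℕ} {ε L L' Lm μ : ℝ} {f m : Matrix (Fin n) (Fin p) ℝ → ℝ}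
  {gradf gradm : Matrix (Fin n) (Fin p) ℝ → Matrix (Fin n) (Fin p) ℝ}

lemma IsLandingMerit.hasDerivAt_gradf (h : IsLandingMerit ε L L' Lm μ f gradf m gradm)
    (Y H : Matrix (Fin n) (Fin p) ℝ) (t : ℝ) :
    HasDerivAt (fun s : ℝ => gradf (Y + s • H)) (fderiv ℝ gradf (Y + t • H) H) t :=
  (h.diff_gradf (Y + t • H)).hasFDerivAt.comp_hasDerivAt t (hasDerivAt_line Y H t)

lemma IsLandingMerit.finner_gradm (h : IsLandingMerit ε L L' Lm μ f gradf m gradm)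
    (Y H : Matrix (Fin n) (Fin p) ℝ) :
    finner (gradm Y) H = finner (gradf Y) H
      - (1 / 2) * finner (fderiv ℝ gradf Y H) (Y * (Yᵀ * Y - 1))
      - (1 / 2) * finner (gradf Y) (H * (Yᵀ * Y - 1) + Y * (Hᵀ * Y + Yᵀ * H))
      + μ * finner (Y * (Yᵀ * Y - 1)) H := by
  have h1 := hasDerivAt_comp_line h.diff_m h.fderiv_m Y H 0
  have hY := hasDerivAt_line Y H 0
  have hYt : HasDerivAt (fun s : ℝ => (Y + s • H)ᵀ) Hᵀ 0 := by
    simpa using hasDerivAt_line Yᵀ Hᵀ 0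
  have hD := (hYt.matrixMul hY).sub_const 1
  have hf := hasDerivAt_comp_line h.diff_f h.fderiv_f Y H 0
  have hg := h.hasDerivAt_gradf Y H 0
  have h2 := (hf.sub ((hg.finner (hY.matrixMul hD)).const_mul (1 / 2))).add
    ((hD.finner hD).const_mul (μ * (1 / 4)))
  have h3 : (fun s : ℝ => m (Y + s • H)) = fun s => f (Y + s • H) - (1 / 2) *
      finner (gradf (Y + s • H)) ((Y + s • H) * ((Y + s • H)ᵀ * (Y + s • H) - 1)) +
      μ * (1 / 4) * finner ((Y + s • H)ᵀ * (Y + s • H) - 1) ((Y + s • H)ᵀ * (Y + s • H) - 1) := by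
    funext s
    rw [h.merit_eq, penaltyN_eq_finner]
    ring
  rw [h3] at h1
  have h4 := h1.unique h2
  simp only [zero_smul, add_zero] at h4
  rw [h4]
  have h5 : finner (Yᵀ * Y - 1) (Yᵀ * H + Hᵀ * Y) = 2 * finner (Y * (Yᵀ * Y - 1)) H := by
    have h6 := finner_transpose (Yᵀ * Y - 1) (Yᵀ * H)
    rw [gram_sub_one_transpose, Matrix.transpose_mul, Matrix.transpose_transpose] at h6
    rw [finner_add_right, h6, finner_comm, finner_comm _ H, finner_mul_right_left]
    ring
  rw [finner_comm (Yᵀ * H + Hᵀ * Y), h5, finner_comm (Y * (Yᵀ * Y - 1)) H,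
    add_comm (Y * (Yᵀ * H + Hᵀ * Y)), add_comm (Yᵀ * H)]
  ring

lemma IsLandingMerit.descent (h : IsLandingMerit ε L L' Lm μ f gradf m gradm)
    (Y H : Matrix (Fin n) (Fin p) ℝ) :
    m (Y + H) ≤ m Y + finner (gradm Y) H + Lm / 2 * fnorm H ^ 2 := by
  let F : ℝ → ℝ := fun t =>
    m Y + t * finner (gradm Y) H + Lm / 2 * t ^ 2 * fnorm H ^ 2 - m (Y + t • H)
  have hF : ∀ t, HasDerivAt F (finner (gradm Y) H + Lm * t * fnorm H ^ 2 -
      finner (gradm (Y + t • H)) H) t := by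
    intro t
    have h1 := hasDerivAt_comp_line h.diff_m h.fderiv_m Y H t
    have h2 := (((hasDerivAt_id t).mul_const (finner (gradm Y) H)).const_add (m Y)).add
      (((hasDerivAt_pow 2 t).const_mul (Lm / 2)).mul_const (fnorm H ^ 2))
    refine (h2.sub h1).congr_deriv ?_
    norm_num
    exact Or.inl (by ring)
  have hmono : MonotoneOn F (Set.Icc 0 1) := by
    refine monotoneOn_of_deriv_nonneg (convex_Icc 0 1)
      (fun t _ => (hF t).continuousAt.continuousWithinAt)
      (fun t _ => (hF t).differentiableAt.differentiableWithinAt) fun t ht => ?_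
    rw [interior_Icc] at ht
    rw [(hF t).deriv]
    have h3 := finner_le (gradm (Y + t • H) - gradm Y) H
    have h4 := h.gradm_lip (Y + t • H) Y
    rw [add_sub_cancel_left, fnorm_smul, abs_of_pos ht.1] at h4
    rw [finner_sub_left] at h3
    nlinarith [mul_le_mul_of_nonneg_right h4 (fnorm_nonneg H)]
  have h5 := hmono (Set.left_mem_Icc.2 zero_le_one) (Set.right_mem_Icc.2 zero_le_one) zero_le_one
  simp only [F, zero_smul, add_zero, one_smul] at h5
  linarith

/-- Trapezoidal estimate along a segment contained in the safe region. -/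
lemma IsLandingMerit.sub_segment_ge (h : IsLandingMerit ε L L' Lm μ f gradf m gradm)
    (Y H : Matrix (Fin n) (Fin p) ℝ) {a : ℝ} (ha : 0 ≤ a) (ha' : a ≤ 1 / 2)
    (hseg : ∀ t ∈ Set.Icc 0 a, fnorm ((Y - t • H)ᵀ * (Y - t • H) - 1) ≤ ε) :
    -(L * fnorm H ^ 2 * (a * (1 - a) / 2)) ≤ f Y - f (Y - a • H) - (1 / 2) * finner (gradf Y) H +
      (1 / 2) * (1 - 2 * a) * finner (gradf (Y - a • H)) H := by
  have hneg : ∀ t : ℝ, Y - t • H = Y + t • (-H) := fun t => by simp [sub_eq_add_neg]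
  let F : ℝ → ℝ := fun t => f Y - f (Y + t • (-H)) - (1 / 2) * finner (gradf Y) H +
      (1 / 2 - t) * finner (gradf (Y + t • (-H))) H +
      L * fnorm H ^ 2 * (t / 2 - t ^ 2 / 2)
  have hF : ∀ t, HasDerivAt F ((1 / 2 - t) * finner (fderiv ℝ gradf (Y + t • (-H)) (-H)) H +
      L * fnorm H ^ 2 * (1 / 2 - t)) t := by
    intro t
    have h1 := hasDerivAt_comp_line h.diff_f h.fderiv_f Y (-H) t
    have h2 := (h.hasDerivAt_gradf Y (-H) t).finner (hasDerivAt_const t H)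
    have h3 := ((hasDerivAt_id t).const_sub (1 / 2)).mul h2
    have h4 := (((hasDerivAt_id t).div_const 2).sub
      ((hasDerivAt_pow 2 t).div_const 2)).const_mul (L * fnorm H ^ 2)
    refine ((((h1.const_sub (f Y)).sub_const ((1 / 2) * finner (gradf Y) H)).add h3).add
      h4).congr_deriv ?_
    simp [finner]
  have hmono : MonotoneOn F (Set.Icc 0 a) := by
    refine monotoneOn_of_deriv_nonneg (convex_Icc 0 a)
      (fun t _ => (hF t).continuousAt.continuousWithinAt)
      (fun t _ => (hF t).differentiableAt.differentiableWithinAt) fun t ht => ?_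
    rw [interior_Icc] at ht
    rw [(hF t).deriv]
    have hreg := hseg t ⟨ht.1.le, ht.2.le⟩
    rw [hneg] at hreg
    have h3 := abs_le.1 (abs_finner_le (fderiv ℝ gradf (Y + t • (-H)) (-H)) H)
    have h4 := h.hess_le _ hreg (-H)
    rw [fnorm_neg] at h4
    have h5 := mul_le_mul_of_nonneg_right h4 (fnorm_nonneg H)
    have h6 : 0 ≤ 1 / 2 - t := by linarith [ht.2]
    nlinarith [mul_nonneg h6 (by linarith [h3.1] :
      0 ≤ finner (fderiv ℝ gradf (Y + t • (-H)) (-H)) H + L * fnorm H * fnorm H)]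
  have h5 := hmono (Set.left_mem_Icc.2 ha) (Set.right_mem_Icc.2 ha) ha
  simp only [F, zero_smul, add_zero] at h5
  rw [hneg]
  linarith

lemma IsLandingMerit.abs_finner_gradf_sub_le (h : IsLandingMerit ε L L' Lm μ f gradf m gradm)
    (Y H B : Matrix (Fin n) (Fin p) ℝ) {a : ℝ} (ha : 0 ≤ a)
    (hseg : ∀ t ∈ Set.Icc 0 a, fnorm ((Y - t • H)ᵀ * (Y - t • H) - 1) ≤ ε) :
    |finner (gradf (Y - a • H) - gradf Y) B| ≤ L * a * fnorm H * fnorm B := by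
  have hneg : ∀ t : ℝ, Y - t • H = Y + t • (-H) := fun t => by simp [sub_eq_add_neg]
  have hF : ∀ t, HasDerivAt (fun s : ℝ => finner (gradf (Y + s • (-H))) B)
      (finner (fderiv ℝ gradf (Y + t • (-H)) (-H)) B) t := by
    intro t
    refine ((h.hasDerivAt_gradf Y (-H) t).finner (hasDerivAt_const t B)).congr_deriv ?_
    simp [finner]
  have h1 := (convex_Icc 0 a).norm_image_sub_le_of_norm_hasDerivWithin_le
    (fun t _ => (hF t).hasDerivWithinAt) (C := L * fnorm H * fnorm B) (fun t ht => ?_)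
    (Set.left_mem_Icc.2 ha) (Set.right_mem_Icc.2 ha)
  · rw [finner_sub_left, hneg]
    simp only [zero_smul, add_zero, sub_zero, Real.norm_eq_abs, abs_of_nonneg ha] at h1
    linarith
  · have hreg := hseg t ht
    rw [hneg] at hreg
    have h4 := h.hess_le _ hreg (-H)
    rw [fnorm_neg] at h4
    exact (abs_finner_le _ _).trans (mul_le_mul_of_nonneg_right h4 (fnorm_nonneg B))

end merit

/-- The point reached from `X` by a step of length `a` along `-X * (Xᵀ * X - 1)`. -/
def normalStep {n p : ℕ} (a : ℝ) (X : Matrix (Fin n) (Fin p) ℝ) : Matrix (Fin n) (Fin p) ℝ :=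
  X - a • (X * (Xᵀ * X - 1))

lemma exists_spectral_gram {n p : ℕ} {ε : ℝ} {X : Matrix (Fin n) (Fin p) ℝ}
    (hX : fnorm (Xᵀ * X - 1) ≤ ε) :
    ∃ (U : Matrix (Fin p) (Fin p) ℝ) (d : Fin p → ℝ), U * Uᵀ = 1 ∧ Uᵀ * U = 1 ∧
      Xᵀ * X - 1 = spectralMat U d ∧ (∀ i, |d i| ≤ fnorm (Xᵀ * X - 1)) ∧ (∀ i, |d i| ≤ ε) := by
  obtain ⟨U, d, hU, hU', hd⟩ := exists_spectralMat (gram_sub_one_transpose X)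
  have key : ∀ i, |d i| ≤ fnorm (Xᵀ * X - 1) := fun i => by
    refine abs_le_of_sq_le_sq ?_ (fnorm_nonneg _)
    rw [hd, fnorm_spectralMat_sq hU']
    exact Finset.single_le_sum (f := fun i => d i ^ 2) (fun j _ => sq_nonneg _)
      (Finset.mem_univ i)
  exact ⟨U, d, hU, hU', hd, key, fun i => (key i).trans hX⟩

section spectralStep

variable {n p : ℕ} {U : Matrix (Fin p) (Fin p) ℝ} {d : Fin p → ℝ} {X : Matrix (Fin n) (Fin p) ℝ}

lemma normalStep_eq_mul (hU : U * Uᵀ = 1) (hX : Xᵀ * X - 1 = spectralMat U d) (a : ℝ) :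
    normalStep a X = X * spectralMat U (1 - a • d) := by
  rw [normalStep, hX, ← spectralMat_sub, spectralMat_one hU, ← spectralMat_smul, Matrix.mul_sub,
    Matrix.mul_one, Matrix.mul_smul]

lemma normalStep_gram (hU : U * Uᵀ = 1) (hU' : Uᵀ * U = 1)
    (hX : Xᵀ * X - 1 = spectralMat U d) (a : ℝ) :
    (normalStep a X)ᵀ * normalStep a X - 1 =
      spectralMat U fun i => d i * (1 - a * (1 + d i) * (2 - a * d i)) := by
  have hXX : Xᵀ * X = spectralMat U (1 + d) := by
    rw [← spectralMat_add, ← hX, spectralMat_one hU]; abel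
  have h1 : (normalStep a X)ᵀ * normalStep a X =
      spectralMat U (1 - a • d) * (Xᵀ * X) * spectralMat U (1 - a • d) := by
    rw [normalStep_eq_mul hU hX, Matrix.transpose_mul, spectralMat_transpose]
    simp only [Matrix.mul_assoc]
  rw [h1, hXX, spectralMat_mul hU', spectralMat_mul hU', ← spectralMat_one hU, spectralMat_sub]
  congr 1
  funext i
  simp only [Pi.mul_apply, Pi.sub_apply, Pi.add_apply, Pi.one_apply, Pi.smul_apply, smul_eq_mul]
  ring

end spectralStep

lemma abs_contraction_factor_le {ε a δ : ℝ} (hε1 : ε ≤ 3 / 4) (ha : 0 ≤ a)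
    (ha' : a ≤ 1 / 2) (hδ : |δ| ≤ ε) :
    |1 - a * (1 + δ) * (2 - a * δ)| ≤ 1 - 2 * a * (1 - ε) := by
  obtain ⟨h1, h2⟩ := abs_le.1 hδ
  have hε0 : 0 ≤ ε := by linarith
  have key1 : 2 * (1 - ε) ≤ (1 + δ) * (2 - a * δ) := by
    nlinarith [mul_nonneg ha (mul_nonneg (by linarith : 0 ≤ ε - δ) (by linarith : 0 ≤ ε + δ)),
      mul_nonneg (by linarith : 0 ≤ 1 / 2 - a) (by linarith : 0 ≤ ε + δ),
      mul_nonneg ha hε0, mul_nonneg ha (mul_nonneg hε0 (by linarith : 0 ≤ 1 - ε))]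
  have key2 : (1 + δ) * (2 - a * δ) ≤ 2 + 2 * ε := by
    nlinarith [mul_nonneg ha (sq_nonneg δ), mul_nonneg (by linarith : 0 ≤ 1 / 2 - a)
      (by linarith : 0 ≤ ε - δ), mul_nonneg ha (by linarith : 0 ≤ ε - δ),
      mul_nonneg ha (by linarith : 0 ≤ ε + δ), mul_nonneg ha hε0]
  rw [abs_le]
  constructor <;> nlinarith [mul_le_mul_of_nonneg_left key1 ha, mul_le_mul_of_nonneg_left key2 ha]

section normalStep

variable {n p : ℕ} {ε a : ℝ} {X : Matrix (Fin n) (Fin p) ℝ}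

lemma fnorm_gram_normalStep_le (hε1 : ε ≤ 3 / 4) (ha : 0 ≤ a) (ha' : a ≤ 1 / 2)
    (hX : fnorm (Xᵀ * X - 1) ≤ ε) :
    fnorm ((normalStep a X)ᵀ * normalStep a X - 1) ≤
      (1 - 2 * a * (1 - ε)) * fnorm (Xᵀ * X - 1) := by
  obtain ⟨U, d, hU, hU', hd, -, hdε⟩ := exists_spectral_gram hX
  have hε0 : 0 ≤ ε := (fnorm_nonneg _).trans hX
  have hr : 0 ≤ 1 - 2 * a * (1 - ε) := by nlinarith
  refine (sq_le_sq₀ (fnorm_nonneg _) (mul_nonneg hr (fnorm_nonneg _))).1 ?_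
  rw [mul_pow, normalStep_gram hU hU' hd, hd, fnorm_spectralMat_sq hU', fnorm_spectralMat_sq hU',
    Finset.mul_sum]
  refine Finset.sum_le_sum fun i _ => ?_
  rw [mul_pow, mul_comm]
  have h := pow_le_pow_left₀ (abs_nonneg _) (abs_contraction_factor_le hε1 ha ha' (hdε i)) 2
  rw [sq_abs] at h
  exact mul_le_mul_of_nonneg_right h (sq_nonneg _)

lemma gram_normalStep_le (hε1 : ε ≤ 3 / 4) (ha : 0 ≤ a) (ha' : a ≤ 1 / 2)
    (hX : fnorm (Xᵀ * X - 1) ≤ ε) :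
    fnorm ((normalStep a X)ᵀ * normalStep a X - 1) ≤ ε := by
  refine (fnorm_gram_normalStep_le hε1 ha ha' hX).trans ?_
  nlinarith [fnorm_nonneg (Xᵀ * X - 1), mul_nonneg (mul_nonneg ha (by linarith : 0 ≤ 1 - ε))
    (fnorm_nonneg (Xᵀ * X - 1))]

lemma penaltyN_normalStep_le (hε1 : ε ≤ 3 / 4) (ha : 0 ≤ a) (ha' : a ≤ 1 / 2)
    (hX : fnorm (Xᵀ * X - 1) ≤ ε) :
    penaltyN (normalStep a X) ≤ (1 - 2 * a * (1 - ε)) ^ 2 * penaltyN X := by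
  have h := pow_le_pow_left₀ (fnorm_nonneg _) (fnorm_gram_normalStep_le hε1 ha ha' hX) 2
  rw [mul_pow] at h
  rw [penaltyN, penaltyN]
  linarith

lemma penaltyN_sub_normalStep (hX : fnorm (Xᵀ * X - 1) ≤ ε) {c : ℝ}
    (hc : ∀ δ : ℝ, |δ| ≤ ε →
      c * (1 + δ) ≤ 1 / 4 * (1 - (1 - a * (1 + δ) * (2 - a * δ)) ^ 2)) :
    c * fnorm (X * (Xᵀ * X - 1)) ^ 2 ≤ penaltyN X - penaltyN (normalStep a X) := by
  obtain ⟨U, d, hU, hU', hd, -, hdε⟩ := exists_spectral_gram hX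
  rw [penaltyN, penaltyN, normalStep_gram hU hU' hd]
  conv_lhs => rw [hd]
  rw [fnorm_mul_spectralMat_sq hU hU' hd, hd, fnorm_spectralMat_sq hU', fnorm_spectralMat_sq hU',
    ← mul_sub, ← Finset.sum_sub_distrib, Finset.mul_sum, Finset.mul_sum]
  refine Finset.sum_le_sum fun i _ => ?_
  nlinarith [mul_le_mul_of_nonneg_left (hc (d i) (hdε i)) (sq_nonneg (d i))]

lemma penaltyN_sub_normalStep_ge (hε1 : ε ≤ 3 / 4) (ha : 0 ≤ a) (ha' : a ≤ 1 / 2)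
    (hX : fnorm (Xᵀ * X - 1) ≤ ε) :
    a * (1 - 3 * a) * fnorm (X * (Xᵀ * X - 1)) ^ 2 ≤ penaltyN X - penaltyN (normalStep a X) := by
  refine penaltyN_sub_normalStep hX fun δ hδ => ?_
  obtain ⟨h1, h2⟩ := abs_le.1 hδ
  have e : 1 / 4 * (1 - (1 - a * (1 + δ) * (2 - a * δ)) ^ 2) - a * (1 - 3 * a) * (1 + δ) =
      a * a * (1 + δ) * (3 - δ / 2 - (1 + δ) * (2 - a * δ) ^ 2 / 4) := by ring
  have k : (2 - a * δ) ^ 2 / 4 ≤ 3 / 2 := by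
    have k1 : a * δ ≤ 3 / 8 := by nlinarith
    have k2 : -(3 / 8) ≤ a * δ := by nlinarith
    nlinarith
  have : 0 ≤ a * a * (1 + δ) * (3 - δ / 2 - (1 + δ) * (2 - a * δ) ^ 2 / 4) := by
    refine mul_nonneg (mul_nonneg (mul_self_nonneg a) (by linarith)) ?_
    nlinarith [mul_le_mul_of_nonneg_left k (by linarith : 0 ≤ 1 + δ)]
  linarith

lemma contraction_defect_ge {δ : ℝ} (hε1 : ε ≤ 3 / 4) (ha : 0 ≤ a) (ha' : a ≤ 1 / 2)
    (h1 : -ε ≤ δ) (h2 : δ ≤ ε) :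
    (3 - 4 * ε) * (1 - a) ≤ (1 - ε) * ((2 - a * δ) * (2 - a * (1 + δ) * (2 - a * δ))) := by
  have hε0 : 0 ≤ ε := by linarith
  have k1 : (2 - a * ε) * (2 - a * (1 + ε) * (2 - a * ε)) ≤
      (2 - a * δ) * (2 - a * (1 + δ) * (2 - a * δ)) := by
    have e : (2 - a * δ) * (2 - a * (1 + δ) * (2 - a * δ)) -
        (2 - a * ε) * (2 - a * (1 + ε) * (2 - a * ε)) = a * (ε - δ) *
        (2 + (2 - a * ε) ^ 2 - a * (1 + δ) * (4 - a * δ - a * ε)) := by ring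
    have v1 : a * ε ≤ 3 / 8 := by nlinarith
    have v2 : -(3 / 8) ≤ a * δ := by nlinarith
    have v3 : a * (1 + δ) ≤ 7 / 8 := by nlinarith
    have v4 : a * (1 + δ) * (4 - a * δ - a * ε) ≤ 7 / 8 * (35 / 8) :=
      mul_le_mul v3 (by nlinarith) (by nlinarith) (by norm_num)
    have : 0 ≤ a * (ε - δ) * (2 + (2 - a * ε) ^ 2 - a * (1 + δ) * (4 - a * δ - a * ε)) :=
      mul_nonneg (mul_nonneg ha (by linarith)) (by nlinarith)
    linarith
  have k2 : (3 - ε - ε ^ 2) * (1 - a) ≤ (2 - a * ε) * (2 - a * (1 + ε) * (2 - a * ε)) := by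
    have u1 : a * ε ≤ 3 / 8 := by nlinarith
    have u2 : 0 ≤ a ^ 2 * ε * (1 + ε) := by positivity
    have u3 : a * ε * (a ^ 2 * ε * (1 + ε)) ≤ 3 / 8 * (a ^ 2 * ε * (1 + ε)) :=
      mul_le_mul_of_nonneg_right u1 u2
    have u4 : 0 ≤ (1 / 2 - a) ^ 2 * (ε * (1 + ε)) := by positivity
    have u5 : 0 ≤ (1 / 2 - a) * (1 + 27 / 8 * ε - 21 / 8 * ε ^ 2) :=
      mul_nonneg (by linarith) (by nlinarith)
    nlinarith [sq_nonneg (ε - 17 / 30)]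
  have k3 : 3 - 4 * ε ≤ (1 - ε) * (3 - ε - ε ^ 2) := by nlinarith [pow_nonneg hε0 3]
  calc (3 - 4 * ε) * (1 - a) ≤ (1 - ε) * (3 - ε - ε ^ 2) * (1 - a) :=
        mul_le_mul_of_nonneg_right k3 (by linarith)
    _ = (1 - ε) * ((3 - ε - ε ^ 2) * (1 - a)) := by ring
    _ ≤ _ := mul_le_mul_of_nonneg_left (k2.trans k1) (by linarith)

lemma penaltyN_sub_normalStep_ge' (hε1 : ε ≤ 3 / 4) (ha : 0 ≤ a)
    (ha' : a ≤ 1 / 2) (hX : fnorm (Xᵀ * X - 1) ≤ ε) :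
    (3 - 4 * ε) * (a * (1 - a)) * fnorm (X * (Xᵀ * X - 1)) ^ 2 ≤
      4 * (1 - ε) * (penaltyN X - penaltyN (normalStep a X)) := by
  have hpos : 0 < 4 * (1 - ε) := by linarith
  have := penaltyN_sub_normalStep (a := a) hX (c := (3 - 4 * ε) * (a * (1 - a)) / (4 * (1 - ε)))
    fun δ hδ => ?_
  · rw [div_mul_eq_mul_div, div_le_iff₀ hpos] at this
    linarith
  · rw [div_mul_eq_mul_div, div_le_iff₀ hpos]
    obtain ⟨h1, h2⟩ := abs_le.1 hδ
    have e : 1 / 4 * (1 - (1 - a * (1 + δ) * (2 - a * δ)) ^ 2) * (4 * (1 - ε)) -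
        (3 - 4 * ε) * (a * (1 - a)) * (1 + δ) = a * (1 + δ) *
        ((1 - ε) * ((2 - a * δ) * (2 - a * (1 + δ) * (2 - a * δ))) - (3 - 4 * ε) * (1 - a)) := by
      ring
    have : 0 ≤ a * (1 + δ) *
        ((1 - ε) * ((2 - a * δ) * (2 - a * (1 + δ) * (2 - a * δ))) - (3 - 4 * ε) * (1 - a)) := by
      refine mul_nonneg (mul_nonneg ha (by linarith)) ?_
      linarith [contraction_defect_ge hε1 ha ha' h1 h2]
    linarith

lemma fnorm_normalStep_mul_sub_le (hε1 : ε ≤ 3 / 4) (ha : 0 ≤ a) (ha' : a ≤ 1 / 2)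
    (hX : fnorm (Xᵀ * X - 1) ≤ ε) :
    fnorm (normalStep a X * ((normalStep a X)ᵀ * normalStep a X - 1) -
        (1 - 2 * a) • (X * (Xᵀ * X - 1))) ≤
      3 * a * (1 - a) * Real.sqrt (1 + ε) * fnorm (Xᵀ * X - 1) ^ 2 := by
  obtain ⟨U, d, hU, hU', hd, hdd, hdε⟩ := exists_spectral_gram hX
  have hε0 : 0 ≤ ε := (fnorm_nonneg _).trans hX
  have h1 : normalStep a X * ((normalStep a X)ᵀ * normalStep a X - 1) -
      (1 - 2 * a) • (X * (Xᵀ * X - 1)) = X * spectralMat U fun i =>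
        -(a * d i ^ 2 * (3 * (1 - a) - 3 * a * d i + a ^ 2 * d i + a ^ 2 * d i ^ 2)) := by
    rw [normalStep_gram hU hU' hd, normalStep_eq_mul hU hd, hd, Matrix.mul_assoc,
      spectralMat_mul hU', ← Matrix.mul_smul, spectralMat_smul, ← Matrix.mul_sub, spectralMat_sub]
    congr 2
    funext i
    simp only [Pi.mul_apply, Pi.sub_apply, Pi.one_apply, Pi.smul_apply, smul_eq_mul]
    ring
  have hC : 0 ≤ 3 * a * (1 - a) * Real.sqrt (1 + ε) * fnorm (Xᵀ * X - 1) ^ 2 :=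
    mul_nonneg (mul_nonneg (mul_nonneg (by linarith) (by linarith)) (Real.sqrt_nonneg _))
      (sq_nonneg _)
  refine (sq_le_sq₀ (fnorm_nonneg _) hC).1 ?_
  have h2 : (3 * a * (1 - a) * Real.sqrt (1 + ε) * fnorm (Xᵀ * X - 1) ^ 2) ^ 2 =
      ∑ i, 9 * a ^ 2 * (1 - a) ^ 2 * (1 + ε) * fnorm (Xᵀ * X - 1) ^ 2 * d i ^ 2 := by
    rw [← Finset.mul_sum, ← fnorm_spectralMat_sq hU', ← hd, mul_pow, mul_pow (3 * a * (1 - a)),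
      Real.sq_sqrt (by linarith)]
    ring
  rw [h1, fnorm_mul_spectralMat_sq hU hU' hd, h2]
  refine Finset.sum_le_sum fun i _ => ?_
  have hd1 := abs_le.1 (hdε i)
  have hd2 : d i ^ 2 ≤ fnorm (Xᵀ * X - 1) ^ 2 := sq_le_sq.2 ((hdd i).trans (le_abs_self _))
  have hQ : (3 * (1 - a) - 3 * a * d i + a ^ 2 * d i + a ^ 2 * d i ^ 2) ^ 2 * (1 + d i) ≤
      9 * (1 - a) ^ 2 * (1 + ε) := by
    generalize d i = δ at hd1
    obtain ⟨k1, k2⟩ := hd1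
    have hQ0 : 0 ≤ 3 * (1 - a) - 3 * a * δ + a ^ 2 * δ + a ^ 2 * δ ^ 2 := by
      nlinarith [mul_nonneg ha (by linarith : 0 ≤ 3 / 4 - δ), mul_nonneg (sq_nonneg a)
        (sq_nonneg (δ + 1 / 2))]
    rcases le_total 0 δ with h0 | h0
    · have hQ1 : 3 * (1 - a) - 3 * a * δ + a ^ 2 * δ + a ^ 2 * δ ^ 2 ≤ 3 * (1 - a) := by
        nlinarith [mul_nonneg (mul_nonneg ha h0) (by nlinarith : 0 ≤ 3 - a - a * δ)]
      nlinarith [pow_le_pow_left₀ hQ0 hQ1 2, mul_nonneg (sq_nonneg (1 - a))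
        (by linarith : 0 ≤ ε - δ), mul_le_mul_of_nonneg_right (pow_le_pow_left₀ hQ0 hQ1 2)
        (by linarith : 0 ≤ 1 + δ)]
    · have hQ1 : 3 * (1 - a) - 3 * a * δ + a ^ 2 * δ + a ^ 2 * δ ^ 2 ≤
          3 * (1 - a) * (1 - δ) := by
        nlinarith [mul_nonneg (by linarith : 0 ≤ 1 / 2 - a) (by linarith : 0 ≤ -δ),
          mul_nonneg (sq_nonneg a) (mul_nonneg (by linarith : 0 ≤ -δ) (by linarith : 0 ≤ 1 + δ))]
      have hs : (1 - δ) ^ 2 * (1 + δ) ≤ 1 + ε := by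
        nlinarith [mul_nonneg (by linarith : 0 ≤ 1 - δ) (sq_nonneg δ)]
      calc _ ≤ (3 * (1 - a) * (1 - δ)) ^ 2 * (1 + δ) :=
            mul_le_mul_of_nonneg_right (pow_le_pow_left₀ hQ0 hQ1 2) (by linarith)
        _ = 9 * (1 - a) ^ 2 * ((1 - δ) ^ 2 * (1 + δ)) := by ring
        _ ≤ _ := mul_le_mul_of_nonneg_left hs (by positivity)
  calc _ = a ^ 2 * d i ^ 2 * d i ^ 2 *
        ((3 * (1 - a) - 3 * a * d i + a ^ 2 * d i + a ^ 2 * d i ^ 2) ^ 2 * (1 + d i)) := by ring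
    _ ≤ a ^ 2 * fnorm (Xᵀ * X - 1) ^ 2 * d i ^ 2 * (9 * (1 - a) ^ 2 * (1 + ε)) := by
        refine mul_le_mul ?_ hQ (mul_nonneg (sq_nonneg _) (by linarith)) (by positivity)
        exact mul_le_mul_of_nonneg_right (mul_le_mul_of_nonneg_left hd2 (sq_nonneg a)) (sq_nonneg _)
    _ = _ := by ring

end normalStep

lemma IsLandingMerit.normalStep_decrease {n p : ℕ} {ε L L' Lm μ : ℝ}
    {f m : Matrix (Fin n) (Fin p) ℝ → ℝ}
    {gradf gradm : Matrix (Fin n) (Fin p) ℝ → Matrix (Fin n) (Fin p) ℝ}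
    (h : IsLandingMerit ε L L' Lm μ f gradf m gradm) (hε1 : ε ≤ 3 / 4) {a : ℝ} (ha : 0 ≤ a)
    (ha' : a ≤ 1 / 2) {X : Matrix (Fin n) (Fin p) ℝ} (hX : fnorm (Xᵀ * X - 1) ≤ ε) :
    μ * (penaltyN X - penaltyN (normalStep a X)) -
      L / 2 * (a * (1 - a)) * fnorm (X * (Xᵀ * X - 1)) ^ 2 -
      3 / 2 * (a * (1 - a)) * Real.sqrt (1 + ε) * L' * fnorm (Xᵀ * X - 1) ^ 2 ≤
      m X - m (normalStep a X) := by
  have h1 := h.sub_segment_ge X (X * (Xᵀ * X - 1)) ha ha' fun t ht =>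
    gram_normalStep_le hε1 ht.1 (ht.2.trans ha') hX
  change _ ≤ f X - f (normalStep a X) - _ + (1 / 2) * (1 - 2 * a) *
    finner (gradf (normalStep a X)) (X * (Xᵀ * X - 1)) at h1
  have hX' := gram_normalStep_le hε1 ha ha' hX
  have h2 := neg_le_of_abs_le (abs_finner_le (gradf (normalStep a X))
    (normalStep a X * ((normalStep a X)ᵀ * normalStep a X - 1) -
        (1 - 2 * a) • (X * (Xᵀ * X - 1))))
  rw [finner_sub_right, finner_smul_right] at h2
  have h3 := mul_le_mul (h.gradf_le _ hX') (fnorm_normalStep_mul_sub_le hε1 ha ha' hX)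
    (fnorm_nonneg _) ((fnorm_nonneg _).trans (h.gradf_le _ hX'))
  rw [h.merit_eq X, h.merit_eq (normalStep a X)]
  linarith

section merit

variable {n p : ℕ} {ε L L' Lm μ M mstar : ℝ} {f m : Matrix (Fin n) (Fin p) ℝ → ℝ}
  {gradf gradm : Matrix (Fin n) (Fin p) ℝ → Matrix (Fin n) (Fin p) ℝ}

lemma penaltyN_sub_normalStep_ge_gram {a : ℝ} {X : Matrix (Fin n) (Fin p) ℝ} (hε1 : ε ≤ 3 / 4)
    (ha : 0 ≤ a) (ha' : a ≤ 1 / 2) (hX : fnorm (Xᵀ * X - 1) ≤ ε) :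
    a * (1 - ε) * (1 - a + a * ε) * fnorm (Xᵀ * X - 1) ^ 2 ≤
      penaltyN X - penaltyN (normalStep a X) := by
  have h := penaltyN_normalStep_le hε1 ha ha' hX
  have e : penaltyN X = 1 / 4 * fnorm (Xᵀ * X - 1) ^ 2 := rfl
  rw [e] at h ⊢
  linarith

lemma IsLandingMerit.normalStep_decrease_penalized
    (h : IsLandingMerit ε L L' Lm μ f gradf m gradm) (hε1 : ε ≤ 3 / 4) (hL : 0 ≤ L)
    (hL' : 0 ≤ L')
    (hμ : (3 - 4 * ε) * μ = 4 * (M + (L * (1 - ε) / 2 + 3 / 2 * Real.sqrt (1 + ε) * L')))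
    {a : ℝ} (ha : 0 ≤ a) (ha' : a ≤ 1 / 2) (haM : 4 * L * a ≤ M)
    {X : Matrix (Fin n) (Fin p) ℝ} (hX : fnorm (Xᵀ * X - 1) ≤ ε) :
    m (normalStep a X) - μ / (4 * (1 - ε)) * penaltyN (normalStep a X) ≤
      m X - μ / (4 * (1 - ε)) * penaltyN X := by
  have hε0 : 0 ≤ ε := (fnorm_nonneg _).trans hX
  have h1 := h.normalStep_decrease hε1 ha ha' hX
  have h2 := penaltyN_sub_normalStep_ge hε1 ha ha' hX
  have h3 := penaltyN_sub_normalStep_ge_gram hε1 ha ha' hX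
  have h4 := fnorm_mul_sq_le hX (Xᵀ * X - 1)
  set D := penaltyN X - penaltyN (normalStep a X) with hD
  set q := fnorm (X * (Xᵀ * X - 1)) ^ 2
  set d2 := fnorm (Xᵀ * X - 1) ^ 2
  have hd2 : 0 ≤ d2 := sq_nonneg _
  have hs : 0 ≤ Real.sqrt (1 + ε) := Real.sqrt_nonneg _
  set s := Real.sqrt (1 + ε)
  have hpos : 0 < 1 - ε := by linarith
  have hM : 0 ≤ M := le_trans (by positivity) haM
  have e : μ * D - μ / (4 * (1 - ε)) * D = (M + 3 / 2 * s * L') * (D / (1 - ε)) + L / 2 * D := by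
    have e' : μ - μ / (4 * (1 - ε)) = (M + 3 / 2 * s * L') / (1 - ε) + L / 2 := by
      field_simp
      linear_combination 2 * hμ
    rw [← sub_mul, e']
    ring
  have h5 : a * (1 - a) * d2 ≤ D / (1 - ε) := by
    rw [le_div_iff₀ hpos]
    have : 0 ≤ a * (1 - ε) * (a * ε) * d2 := by positivity
    linarith
  have h6 := mul_le_mul_of_nonneg_left h5 (by positivity : 0 ≤ M + 3 / 2 * s * L')
  have h7 := mul_le_mul_of_nonneg_left h2 (by positivity : 0 ≤ L / 2)
  have h8 : L * a ^ 2 * q ≤ M * (a * (1 - a) * d2) := by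
    calc L * a ^ 2 * q ≤ L * a ^ 2 * (2 * d2) := by
          refine mul_le_mul_of_nonneg_left ?_ (by positivity)
          nlinarith
      _ = 4 * L * a * (a * (1 / 2) * d2) := by ring
      _ ≤ M * (a * (1 / 2) * d2) := mul_le_mul_of_nonneg_right haM (by positivity)
      _ ≤ _ := by
          refine mul_le_mul_of_nonneg_left ?_ hM
          exact mul_le_mul_of_nonneg_right (mul_le_mul_of_nonneg_left (by linarith) ha) hd2
  linarith

/-- A uniform lower bound of the merit function on the safe region improves by a multiple of the
penalty. -/
lemma IsLandingMerit.merit_ge_add_penalty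
    (h : IsLandingMerit ε L L' Lm μ f gradf m gradm) (hε1 : ε ≤ 3 / 4) (hL : 0 < L)
    (hL' : 0 ≤ L')
    (hμ : (3 - 4 * ε) * μ = 4 * (M + (L * (1 - ε) / 2 + 3 / 2 * Real.sqrt (1 + ε) * L')))
    (hM : 0 < M)
    (hmlb : ∀ X : Matrix (Fin n) (Fin p) ℝ, fnorm (Xᵀ * X - 1) ≤ ε → mstar ≤ m X)
    {X : Matrix (Fin n) (Fin p) ℝ} (hX : fnorm (Xᵀ * X - 1) ≤ ε) :
    mstar + μ / (4 * (1 - ε)) * penaltyN X ≤ m X := by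
  have hε0 : 0 ≤ ε := (fnorm_nonneg _).trans hX
  obtain ⟨a, ha, ha', haM⟩ : ∃ a : ℝ, 0 < a ∧ a ≤ 1 / 2 ∧ 4 * L * a ≤ M := by
    refine ⟨min (1 / 2) (M / (4 * L)), by positivity, min_le_left _ _, ?_⟩
    calc 4 * L * min (1 / 2) (M / (4 * L)) ≤ 4 * L * (M / (4 * L)) :=
          mul_le_mul_of_nonneg_left (min_le_right _ _) (by positivity)
      _ = M := by field_simp
  set r := 1 - 2 * a * (1 - ε) with hr
  have hr0 : 0 ≤ r := by nlinarith
  have hr1 : r < 1 := by nlinarith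
  have key : ∀ j : ℕ, fnorm (((normalStep a)^[j] X)ᵀ * (normalStep a)^[j] X - 1) ≤ ε ∧
      penaltyN ((normalStep a)^[j] X) ≤ (r ^ 2) ^ j * penaltyN X ∧
      m ((normalStep a)^[j] X) - μ / (4 * (1 - ε)) * penaltyN ((normalStep a)^[j] X) ≤
      m X - μ / (4 * (1 - ε)) * penaltyN X := by
    intro j
    induction j with
    | zero => simpa using hX
    | succ j ih =>
      obtain ⟨i1, i2, i3⟩ := ih
      rw [Function.iterate_succ_apply']
      refine ⟨gram_normalStep_le hε1 ha.le ha' i1, ?_, ?_⟩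
      · refine (penaltyN_normalStep_le hε1 ha.le ha' i1).trans ?_
        rw [pow_succ' (r ^ 2), mul_assoc (r ^ 2)]
        exact mul_le_mul_of_nonneg_left i2 (sq_nonneg _)
      · exact (h.normalStep_decrease_penalized hε1 hL.le hL' hμ ha.le ha' haM i1).trans i3
  have hlim : Filter.Tendsto (fun j : ℕ => mstar - μ / (4 * (1 - ε)) * ((r ^ 2) ^ j * penaltyN X))
      Filter.atTop (nhds (mstar - μ / (4 * (1 - ε)) * (0 * penaltyN X))) :=
    (((tendsto_pow_atTop_nhds_zero_of_lt_one (sq_nonneg r)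
      (by nlinarith)).mul_const _).const_mul _).const_sub _
  have hμ0 : 0 ≤ μ := by
    have hs := Real.sqrt_nonneg (1 + ε)
    have : 0 ≤ μ * (3 - 4 * ε) := by
      rw [mul_comm, hμ]
      have := mul_nonneg hL.le (by linarith : 0 ≤ 1 - ε)
      positivity
    by_contra hc
    have hpos : 0 < L * (1 - ε) := mul_pos hL (by linarith)
    have : (3 - 4 * ε) * μ ≤ 0 := mul_nonpos_of_nonneg_of_nonpos (by linarith) (by linarith)
    rw [hμ] at this
    have : 0 ≤ 3 / 2 * Real.sqrt (1 + ε) * L' := by positivity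
    linarith
  have := le_of_tendsto' hlim (b := m X - μ / (4 * (1 - ε)) * penaltyN X) fun j => by
    obtain ⟨i1, i2, i3⟩ := key j
    have h1 := hmlb _ i1
    have h2 := mul_le_mul_of_nonneg_left i2
      (div_nonneg hμ0 (by linarith : 0 ≤ 4 * (1 - ε)))
    linarith
  linarith

end merit

section orthonormal

variable {n p : ℕ} {ε L L' Lm μ : ℝ} {f m : Matrix (Fin n) (Fin p) ℝ → ℝ}
  {gradf gradm : Matrix (Fin n) (Fin p) ℝ → Matrix (Fin n) (Fin p) ℝ}

lemma le_of_fnorm_gram_lt_one {X : Matrix (Fin n) (Fin p) ℝ} (hX : fnorm (Xᵀ * X - 1) < 1) :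
    p ≤ n := by
  obtain ⟨U, d, hU, hU', hd, hdd, -⟩ := exists_spectral_gram le_rfl (X := X)
  have hXX : Xᵀ * X = spectralMat U (1 + d) := by
    rw [← spectralMat_add, ← hd, spectralMat_one hU]; abel
  have hinv : spectralMat U (fun i => (1 + d i)⁻¹) * Xᵀ * X = 1 := by
    rw [Matrix.mul_assoc, hXX, spectralMat_mul hU', ← spectralMat_one hU]
    congr 1
    funext i
    have : 1 + d i ≠ 0 := by
      have := (abs_le.1 (hdd i)).1
      linarith
    simpa using inv_mul_cancel₀ this
  have h1 := Matrix.rank_mul_le_right (spectralMat U (fun i => (1 + d i)⁻¹) * Xᵀ) X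
  rw [hinv, Matrix.rank_one, Fintype.card_fin] at h1
  exact h1.trans (Matrix.rank_le_height X)

lemma exists_transpose_mul_self_eq_one (hpn : p ≤ n) :
    ∃ P : Matrix (Fin n) (Fin p) ℝ, Pᵀ * P = 1 := by
  refine ⟨(1 : Matrix (Fin n) (Fin n) ℝ).submatrix id (Fin.castLE hpn), ?_⟩
  rw [Matrix.transpose_submatrix, Matrix.transpose_one,
    ← Matrix.submatrix_mul _ _ _ _ _ Function.bijective_id, Matrix.one_mul,
    Matrix.submatrix_one _ (Fin.castLE_injective hpn)]

variable {P : Matrix (Fin n) (Fin p) ℝ}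

lemma finner_self_of_transpose_mul_self (hP : Pᵀ * P = 1) : finner P P = p := by
  simp [finner, hP]

lemma gram_smul_of_transpose_mul_self (hP : Pᵀ * P = 1) (t : ℝ) :
    ((1 + t) • P)ᵀ * ((1 + t) • P) - 1 = (t * (2 + t)) • (1 : Matrix (Fin p) (Fin p) ℝ) := by
  rw [Matrix.transpose_smul, Matrix.smul_mul, Matrix.mul_smul, hP, smul_smul,
    show t * (2 + t) = (1 + t) * (1 + t) - 1 by ring, sub_smul, one_smul]

lemma IsLandingMerit.finner_gradm_smul (h : IsLandingMerit ε L L' Lm μ f gradf m gradm)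
    (hP : Pᵀ * P = 1) (t : ℝ) :
    finner (gradm ((1 + t) • P)) P =
      -(3 / 2) * (t * (2 + t)) * finner (gradf ((1 + t) • P)) P -
      1 / 2 * (t * (2 + t)) * (1 + t) * finner (fderiv ℝ gradf ((1 + t) • P) P) P +
      μ * (t * (2 + t)) * (1 + t) * p := by
  rw [h.finner_gradm, gram_smul_of_transpose_mul_self hP]
  simp only [Matrix.transpose_smul, Matrix.smul_mul, Matrix.mul_smul, hP, Matrix.mul_one,
    finner_add_right, finner_smul_right, finner_smul_left, Matrix.mul_add,
    finner_self_of_transpose_mul_self hP]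
  ring

lemma IsLandingMerit.lipschitz_ge (h : IsLandingMerit ε L L' Lm μ f gradf m gradm)
    (hp : 0 < p) (hε0 : 0 < ε) (hε1 : ε < 1) (hL' : 0 ≤ L')
    (hμ : 0 ≤ μ - L / 2 - 3 / 2 * L') {X : Matrix (Fin n) (Fin p) ℝ}
    (hX : fnorm (Xᵀ * X - 1) ≤ ε) : 2 * (μ - L / 2 - 3 / 2 * L') ≤ Lm := by
  obtain ⟨P, hP⟩ := exists_transpose_mul_self_eq_one (le_of_fnorm_gram_lt_one (hX.trans_lt hε1))
  have hp1 : (1 : ℝ) ≤ p := by exact_mod_cast hp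
  obtain ⟨t, ht, ht1, htε⟩ : ∃ t : ℝ, 0 < t ∧ t ≤ 1 ∧ 3 * t * p ≤ ε := by
    refine ⟨min 1 (ε / (3 * p)), by positivity, min_le_left _ _, ?_⟩
    calc 3 * min 1 (ε / (3 * p)) * (p : ℝ) ≤ 3 * (ε / (3 * p)) * p := by
          gcongr
          exact min_le_right _ _
      _ = ε := by field_simp
  have hu : 0 < t * (2 + t) := by positivity
  have hY : fnorm (((1 + t) • P)ᵀ * ((1 + t) • P) - 1) ≤ ε := by
    rw [gram_smul_of_transpose_mul_self hP]
    refine le_trans ?_ htε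
    refine (sq_le_sq₀ (fnorm_nonneg _) (by positivity)).1 ?_
    rw [fnorm_sq, finner_smul_left, finner_smul_right,
      finner_self_of_transpose_mul_self (by simp)]
    calc t * (2 + t) * (t * (2 + t) * p) = (t * (2 + t)) ^ 2 * p := by ring
      _ ≤ (t * 3) ^ 2 * (p * p) := by
          gcongr
          · linarith
          · nlinarith
      _ = (3 * t * p) ^ 2 := by ring
  have hPn : fnorm P ^ 2 = p := by rw [fnorm_sq, finner_self_of_transpose_mul_self hP]
  have hPn' : fnorm P ≤ p := by
    refine (sq_le_sq₀ (fnorm_nonneg _) (by positivity)).1 ?_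
    rw [hPn]
    nlinarith
  have h1 : finner (gradf ((1 + t) • P)) P ≤ L' * p :=
    (finner_le _ _).trans (mul_le_mul (h.gradf_le _ hY) hPn' (fnorm_nonneg _) hL')
  have h2 : finner (fderiv ℝ gradf ((1 + t) • P) P) P ≤ L * p :=
    calc _ ≤ L * fnorm P * fnorm P :=
          (finner_le _ _).trans (mul_le_mul_of_nonneg_right (h.hess_le _ hY P) (fnorm_nonneg _))
      _ = L * p := by rw [mul_assoc, ← sq, hPn]
  have h3 : finner (gradm ((1 + t) • P)) P ≤ Lm * t * p := by
    have e0 : finner (gradm ((1 + 0 : ℝ) • P)) P = 0 := by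
      rw [h.finner_gradm_smul hP]
      simp
    have e1 := finner_le (gradm ((1 + t) • P) - gradm ((1 + 0 : ℝ) • P)) P
    have e2 := h.gradm_lip ((1 + t) • P) ((1 + 0 : ℝ) • P)
    rw [← sub_smul, fnorm_smul, show |1 + t - (1 + 0)| = t by
      rw [show 1 + t - (1 + 0) = t by ring, abs_of_pos ht]] at e2
    rw [finner_sub_left, e0] at e1
    have e3 := mul_le_mul_of_nonneg_right e2 (fnorm_nonneg P)
    have e4 : Lm * (t * fnorm P) * fnorm P = Lm * t * p := by rw [← hPn]; ring
    linarith
  rw [h.finner_gradm_smul hP] at h3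
  have h4 := mul_le_mul_of_nonneg_left h1 hu.le
  have h5 := mul_le_mul_of_nonneg_left h2 (by positivity : 0 ≤ t * (2 + t) * (1 + t))
  have h6 : (t * p) * ((2 + t) * ((1 + t) * (μ - L / 2) - 3 / 2 * L')) ≤ (t * p) * Lm := by
    linarith
  have h7 := le_of_mul_le_mul_left h6 (by positivity)
  have h8 : μ - L / 2 - 3 / 2 * L' ≤ (1 + t) * (μ - L / 2) - 3 / 2 * L' := by nlinarith
  nlinarith

end orthonormal

lemma skewPart_transpose {k : ℕ} (M : Matrix (Fin k) (Fin k) ℝ) :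
    (skewPart M)ᵀ = -skewPart M := by
  rw [skewPart, Matrix.transpose_smul, Matrix.transpose_sub, Matrix.transpose_transpose,
    ← smul_neg, neg_sub]

lemma finner_skewPart {k : ℕ} (M : Matrix (Fin k) (Fin k) ℝ) :
    finner M (skewPart M) = fnorm (skewPart M) ^ 2 := by
  have h1 : M = symPart M + skewPart M := by
    rw [symPart, skewPart, ← smul_add, add_add_sub_cancel, ← two_smul ℝ M, smul_smul]
    norm_num
  have h2 : (symPart M)ᵀ = symPart M := by
    rw [symPart, Matrix.transpose_smul, Matrix.transpose_add, Matrix.transpose_transpose, add_comm]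
  conv_lhs => rw [h1]
  rw [finner_add_left, ← h1, finner_skew_symm h2 (skewPart_transpose M), zero_add, fnorm_sq]

lemma fnorm_skewPart_le {k : ℕ} (M : Matrix (Fin k) (Fin k) ℝ) :
    fnorm (skewPart M) ≤ fnorm M := by
  have h := finner_le M (skewPart M)
  rw [finner_skewPart, sq] at h
  rcases (fnorm_nonneg (skewPart M)).eq_or_lt with h0 | h0
  · rw [← h0]
    exact fnorm_nonneg M
  · exact le_of_mul_le_mul_right h h0

section riemannian

variable {n p : ℕ} {ε : ℝ} {X : Matrix (Fin n) (Fin p) ℝ} (g : Matrix (Fin n) (Fin p) ℝ)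

lemma transpose_mul_skewPart_mul :
    (Xᵀ * (skewPart (g * Xᵀ) * X))ᵀ = -(Xᵀ * (skewPart (g * Xᵀ) * X)) := by
  rw [Matrix.transpose_mul, Matrix.transpose_mul, skewPart_transpose, Matrix.transpose_transpose]
  simp [Matrix.mul_assoc]

lemma fnorm_mul_right_le (hX : fnorm (Xᵀ * X - 1) ≤ ε) {k : ℕ} (M : Matrix (Fin k) (Fin n) ℝ) :
    fnorm (M * X) ≤ Real.sqrt (1 + ε) * fnorm M := by
  rw [← fnorm_transpose (M * X), Matrix.transpose_mul, ← fnorm_transpose M]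
  exact fnorm_transpose_mul_le_sqrt hX _

lemma fnorm_skewPart_mul_sq_le (hX : fnorm (Xᵀ * X - 1) ≤ ε) :
    fnorm (skewPart (g * Xᵀ) * X) ^ 2 ≤ (1 + ε) * finner g (skewPart (g * Xᵀ) * X) := by
  have hε0 : 0 ≤ ε := (fnorm_nonneg _).trans hX
  have h := pow_le_pow_left₀ (fnorm_nonneg _) (fnorm_mul_right_le hX (skewPart (g * Xᵀ))) 2
  rw [finner_mul_right_right, finner_skewPart]
  rwa [mul_pow, Real.sq_sqrt (by linarith)] at h

lemma fnorm_skewPart_mul_le (hX : fnorm (Xᵀ * X - 1) ≤ ε) :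
    fnorm (skewPart (g * Xᵀ) * X) ≤ (1 + ε) * fnorm g := by
  have hε0 : 0 ≤ ε := (fnorm_nonneg _).trans hX
  have h1 : fnorm (g * Xᵀ) ≤ Real.sqrt (1 + ε) * fnorm g := by
    rw [← fnorm_transpose (g * Xᵀ), Matrix.transpose_mul, Matrix.transpose_transpose,
      ← fnorm_transpose g]
    exact fnorm_mul_le_sqrt hX _
  calc _ ≤ Real.sqrt (1 + ε) * fnorm (skewPart (g * Xᵀ)) := fnorm_mul_right_le hX _
    _ ≤ Real.sqrt (1 + ε) * (Real.sqrt (1 + ε) * fnorm g) :=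
        mul_le_mul_of_nonneg_left ((fnorm_skewPart_le _).trans h1) (Real.sqrt_nonneg _)
    _ = _ := by rw [← mul_assoc, Real.mul_self_sqrt (by linarith)]

end riemannian

section step

variable {n p : ℕ} {ε a γ lam : ℝ} {X B : Matrix (Fin n) (Fin p) ℝ}

lemma transpose_mul_eq_neg (hB : (Xᵀ * B)ᵀ = -(Xᵀ * B)) : Bᵀ * X = -(Xᵀ * B) := by
  rw [← hB, Matrix.transpose_mul, Matrix.transpose_transpose]

lemma fnorm_landing_sq (hB : (Xᵀ * B)ᵀ = -(Xᵀ * B)) (lam : ℝ) :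
    fnorm (B + lam • (X * (Xᵀ * X - 1))) ^ 2 =
      fnorm B ^ 2 + lam ^ 2 * fnorm (X * (Xᵀ * X - 1)) ^ 2 := by
  rw [fnorm_add_sq, finner_smul_right, finner_mul_right_left, finner_comm,
    finner_skew_symm (gram_sub_one_transpose X) hB, fnorm_smul, mul_pow, sq_abs]
  ring

lemma gram_landing (hB : (Xᵀ * B)ᵀ = -(Xᵀ * B)) (γ lam : ℝ) :
    (X - γ • (B + lam • (X * (Xᵀ * X - 1))))ᵀ * (X - γ • (B + lam • (X * (Xᵀ * X - 1)))) - 1 =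
      (1 - 2 * (γ * lam)) • (Xᵀ * X - 1) -
        (2 * (γ * lam)) • ((Xᵀ * X - 1) * (Xᵀ * X - 1)) +
        γ ^ 2 • ((B + lam • (X * (Xᵀ * X - 1)))ᵀ * (B + lam • (X * (Xᵀ * X - 1)))) := by
  set V := B + lam • (X * (Xᵀ * X - 1)) with hV
  have h1 : Xᵀ * V = Xᵀ * B + lam • ((Xᵀ * X - 1) + (Xᵀ * X - 1) * (Xᵀ * X - 1)) := by
    rw [hV, Matrix.mul_add, Matrix.mul_smul, ← Matrix.mul_assoc]
    congr 2
    rw [Matrix.sub_mul (Xᵀ * X), Matrix.one_mul, add_sub_cancel]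
  have h2 : Vᵀ * X = -(Xᵀ * B) + lam • ((Xᵀ * X - 1) + (Xᵀ * X - 1) * (Xᵀ * X - 1)) := by
    have := congrArg Matrix.transpose h1
    rw [Matrix.transpose_mul, Matrix.transpose_transpose] at this
    rw [this, Matrix.transpose_add, hB, Matrix.transpose_smul, Matrix.transpose_add,
      Matrix.transpose_mul, gram_sub_one_transpose]
  have h3 : (X - γ • V)ᵀ * (X - γ • V) - 1 =
      (Xᵀ * X - 1) - γ • (Xᵀ * V) - γ • (Vᵀ * X) + γ ^ 2 • (Vᵀ * V) := by
    rw [Matrix.transpose_sub, Matrix.transpose_smul, Matrix.sub_mul, Matrix.mul_sub,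
      Matrix.mul_sub, Matrix.smul_mul, Matrix.smul_mul, Matrix.mul_smul, Matrix.mul_smul]
    module
  rw [h3, h1, h2]
  module

lemma fnorm_gram_landing_le (hB : (Xᵀ * B)ᵀ = -(Xᵀ * B)) (hX : fnorm (Xᵀ * X - 1) ≤ ε)
    (ha : 0 ≤ γ * lam) (ha' : γ * lam ≤ 1 / 2)
    (hγ : γ ^ 2 * fnorm B ^ 2 + (γ * lam) ^ 2 * (1 + ε) * ε ^ 2 ≤ 2 * (γ * lam) * ε * (1 - ε)) :
    fnorm ((X - γ • (B + lam • (X * (Xᵀ * X - 1))))ᵀ *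
      (X - γ • (B + lam • (X * (Xᵀ * X - 1)))) - 1) ≤ ε := by
  have hε0 : 0 ≤ ε := (fnorm_nonneg _).trans hX
  rw [gram_landing hB]
  have h4 := fnorm_mul_sq_le hX (Xᵀ * X - 1)
  have h5 := fnorm_landing_sq hB lam
  have h6 := fnorm_mul_le (B + lam • (X * (Xᵀ * X - 1)))ᵀ (B + lam • (X * (Xᵀ * X - 1)))
  rw [fnorm_transpose, ← sq, h5] at h6
  have h7 := fnorm_mul_le (Xᵀ * X - 1) (Xᵀ * X - 1)
  refine (fnorm_add_le _ _).trans ((add_le_add_left (fnorm_sub_le _ _) _).trans ?_)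
  rw [fnorm_smul, fnorm_smul, fnorm_smul, abs_of_nonneg (by linarith), abs_of_nonneg (by linarith),
    abs_of_nonneg (sq_nonneg γ)]
  have hd := fnorm_nonneg (Xᵀ * X - 1)
  set d := fnorm (Xᵀ * X - 1)
  have hdd : d * d ≤ ε * ε := mul_le_mul hX hX hd hε0
  calc _ ≤ (1 - 2 * (γ * lam)) * ε + 2 * (γ * lam) * (ε * ε) +
        γ ^ 2 * (fnorm B ^ 2 + lam ^ 2 * ((1 + ε) * (ε * ε))) := by
        gcongr
        · linarith
        · exact h7.trans hdd
        · refine h6.trans ?_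
          gcongr
          exact h4.trans (by rw [sq]; gcongr)
    _ ≤ ε := by linarith

lemma normalStep_cross (hB : (Xᵀ * B)ᵀ = -(Xᵀ * B)) (a : ℝ) :
    Bᵀ * normalStep a X + (normalStep a X)ᵀ * B =
      -(a • ((Xᵀ * X - 1) * (Xᵀ * B) - Xᵀ * B * (Xᵀ * X - 1))) := by
  have h1 : Bᵀ * normalStep a X = -(Xᵀ * B) + a • (Xᵀ * B * (Xᵀ * X - 1)) := by
    rw [normalStep, Matrix.mul_sub, Matrix.mul_smul, ← Matrix.mul_assoc, transpose_mul_eq_neg hB,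
      Matrix.neg_mul, smul_neg, sub_neg_eq_add]
  have h2 : (normalStep a X)ᵀ * B = Xᵀ * B - a • ((Xᵀ * X - 1) * (Xᵀ * B)) := by
    rw [normalStep, Matrix.transpose_sub, Matrix.transpose_smul, Matrix.transpose_mul,
      gram_sub_one_transpose, Matrix.sub_mul, Matrix.smul_mul, Matrix.mul_assoc]
  rw [h1, h2]
  module

lemma finner_normalStep_gram_comm (hB : (Xᵀ * B)ᵀ = -(Xᵀ * B)) (a : ℝ) :
    finner ((normalStep a X)ᵀ * normalStep a X - 1)
      ((Xᵀ * X - 1) * (Xᵀ * B) - Xᵀ * B * (Xᵀ * X - 1)) = 0 := by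
  obtain ⟨U, d, hU, hU', hd, -, -⟩ := exists_spectral_gram (le_refl (fnorm (Xᵀ * X - 1)))
  rw [normalStep_gram hU hU' hd, hd, finner_sub_right, finner_mul_right_left,
    finner_mul_right_right _ (Xᵀ * B), spectralMat_transpose,
      spectralMat_mul hU', spectralMat_mul hU',
    finner_skew_symm (spectralMat_transpose _) hB,
    finner_skew_symm (spectralMat_transpose _) hB, sub_zero]

lemma finner_normalStep_mul_gram (hB : (Xᵀ * B)ᵀ = -(Xᵀ * B)) (a : ℝ) :
    finner (normalStep a X * ((normalStep a X)ᵀ * normalStep a X - 1)) B = 0 := by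
  obtain ⟨U, d, hU, hU', hd, -, -⟩ := exists_spectral_gram (le_refl (fnorm (Xᵀ * X - 1)))
  rw [normalStep_gram hU hU' hd, normalStep_eq_mul hU hd, finner_comm, Matrix.mul_assoc,
    spectralMat_mul hU', finner_mul_right_left, finner_comm,
    finner_skew_symm (spectralMat_transpose _) hB]

lemma fnorm_commutator_le (hX : fnorm (Xᵀ * X - 1) ≤ ε) (B : Matrix (Fin n) (Fin p) ℝ) :
    fnorm ((Xᵀ * X - 1) * (Xᵀ * B) - Xᵀ * B * (Xᵀ * X - 1)) ≤
      2 * Real.sqrt (1 + ε) * fnorm (Xᵀ * X - 1) * fnorm B := by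
  have h1 := fnorm_mul_le (Xᵀ * X - 1) (Xᵀ * B)
  have h2 := fnorm_mul_le (Xᵀ * B) (Xᵀ * X - 1)
  have h3 := mul_le_mul_of_nonneg_left (fnorm_transpose_mul_le_sqrt hX B)
    (fnorm_nonneg (Xᵀ * X - 1))
  have h4 := fnorm_sub_le ((Xᵀ * X - 1) * (Xᵀ * B)) (Xᵀ * B * (Xᵀ * X - 1))
  linarith

lemma gram_normalStep_sub (hB : (Xᵀ * B)ᵀ = -(Xᵀ * B)) (a γ : ℝ) :
    (normalStep a X - γ • B)ᵀ * (normalStep a X - γ • B) - 1 =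
      ((normalStep a X)ᵀ * normalStep a X - 1) +
      ((γ * a) • ((Xᵀ * X - 1) * (Xᵀ * B) - Xᵀ * B * (Xᵀ * X - 1)) + γ ^ 2 • (Bᵀ * B)) := by
  have h1 : (normalStep a X - γ • B)ᵀ * (normalStep a X - γ • B) - 1 =
      ((normalStep a X)ᵀ * normalStep a X - 1) -
      γ • (Bᵀ * normalStep a X + (normalStep a X)ᵀ * B) + γ ^ 2 • (Bᵀ * B) := by
    rw [Matrix.transpose_sub, Matrix.transpose_smul, Matrix.sub_mul, Matrix.mul_sub,
      Matrix.mul_sub, Matrix.smul_mul, Matrix.smul_mul, Matrix.mul_smul, Matrix.mul_smul]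
    module
  rw [h1, normalStep_cross hB]
  module

lemma penaltyN_normalStep_sub_le (hB : (Xᵀ * B)ᵀ = -(Xᵀ * B)) (hX : fnorm (Xᵀ * X - 1) ≤ ε)
    (hε1 : ε ≤ 3 / 4) (ha : 0 ≤ a) (ha' : a ≤ 1 / 2) (hγ : 0 ≤ γ)
    (hγB : γ ^ 2 * fnorm B ^ 2 + a ^ 2 * (1 + ε) * ε ^ 2 ≤ a * ε * (1 - ε))
    (haε : a * ε * (1 + ε) ≤ 1 - ε) :
    penaltyN (normalStep a X - γ • B) ≤ (1 - 2 * a * (1 - ε)) ^ 2 * penaltyN X +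
      (1 - 2 * a * (1 - ε)) * (γ ^ 2 * fnorm B ^ 2) := by
  have hε0 : 0 ≤ ε := (fnorm_nonneg _).trans hX
  have hN := penaltyN_normalStep_le hε1 ha ha' hX
  have hD := (fnorm_gram_normalStep_le hε1 ha ha' hX)
  have hr : ε ≤ 1 - 2 * a * (1 - ε) := by nlinarith
  set r := 1 - 2 * a * (1 - ε) with hr_def
  set D := (normalStep a X)ᵀ * normalStep a X - 1 with hD_def
  have hC := fnorm_commutator_le hX B
  have hC0 := finner_normalStep_gram_comm hB a
  rw [← hD_def] at hC0
  set C := (Xᵀ * X - 1) * (Xᵀ * B) - Xᵀ * B * (Xᵀ * X - 1)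
  have hz := fnorm_nonneg B
  set z := fnorm B
  have hs := Real.sqrt_nonneg (1 + ε)
  have hs2 := Real.sq_sqrt (by linarith : 0 ≤ 1 + ε)
  set s := Real.sqrt (1 + ε)
  have hBB : fnorm (Bᵀ * B) ≤ z ^ 2 := by
    have := fnorm_mul_le Bᵀ B
    rwa [fnorm_transpose, ← sq] at this
  have hE : fnorm ((γ * a) • C + γ ^ 2 • (Bᵀ * B)) ≤ γ * z * (2 * a * ε * s + γ * z) := by
    refine (fnorm_add_le _ _).trans ?_
    rw [fnorm_smul, fnorm_smul, abs_of_nonneg (by positivity), abs_of_nonneg (by positivity)]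
    calc γ * a * fnorm C + γ ^ 2 * fnorm (Bᵀ * B) ≤
          γ * a * (2 * s * ε * z) + γ ^ 2 * z ^ 2 := by
          gcongr
          exact hC.trans (by gcongr)
      _ = _ := by ring
  have hE2 := pow_le_pow_left₀ (fnorm_nonneg _) hE 2
  have hcross : finner D ((γ * a) • C + γ ^ 2 • (Bᵀ * B)) ≤ γ ^ 2 * (r * ε * z ^ 2) := by
    rw [finner_add_right, finner_smul_right, finner_smul_right, hC0, mul_zero, zero_add]
    refine mul_le_mul_of_nonneg_left ?_ (sq_nonneg γ)
    refine (finner_le _ _).trans ?_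
    refine mul_le_mul (hD.trans ?_) hBB (fnorm_nonneg _) (by nlinarith)
    exact mul_le_mul_of_nonneg_left hX (by linarith)
  have hquad : (2 * a * ε * s + γ * z) ^ 2 ≤ 8 * a * ε * (1 - ε) := by
    have h1 : (2 * a * ε * s + γ * z) ^ 2 ≤ 8 * a ^ 2 * ε ^ 2 * (1 + ε) + 2 * (γ ^ 2 * z ^ 2) := by
      rw [← hs2]
      nlinarith [sq_nonneg (2 * a * ε * s - γ * z)]
    have h2 := mul_le_mul_of_nonneg_left haε (by positivity : 0 ≤ 6 * a * ε)
    linarith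
  have e1 : penaltyN (normalStep a X - γ • B) =
      penaltyN (normalStep a X) + 1 / 2 * finner D ((γ * a) • C + γ ^ 2 • (Bᵀ * B)) +
      1 / 4 * fnorm ((γ * a) • C + γ ^ 2 • (Bᵀ * B)) ^ 2 := by
    rw [penaltyN, gram_normalStep_sub hB, fnorm_add_sq, penaltyN]
    ring
  have h3 := mul_le_mul_of_nonneg_left hquad (by positivity : 0 ≤ γ ^ 2 * z ^ 2)
  have h4 : 1 / 2 * (r * ε) + 2 * a * ε * (1 - ε) ≤ r := by
    have : 2 * a * ε * (1 - ε) = ε * (1 - r) := by rw [hr_def]; ring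
    rw [this]
    nlinarith
  have h5 := mul_le_mul_of_nonneg_right h4 (by positivity : 0 ≤ γ ^ 2 * z ^ 2)
  linarith

end step

lemma quadratic_nonneg_of_coeffs {a c0 c1 c2 : ℝ} (ha : 0 ≤ a) (ha' : a ≤ 1 / 2) (h0 : 0 ≤ c0)
    (h1 : 0 ≤ c1) (h2 : 0 ≤ c2) :
    0 ≤ c0 * (1 - 2 * a) ^ 2 + c1 * (2 * (2 * a) * (1 - 2 * a)) + c2 * (2 * a) ^ 2 := by
  have : 0 ≤ 1 - 2 * a := by linarith
  positivity

lemma tangential_coeff_sq_left {ε a : ℝ} (h0 : 0 ≤ ε) (h1 : 0 ≤ 3 / 4 - ε) (ha : 0 ≤ a)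
    (ha' : a ≤ 1 / 2) :
    0 ≤ (1 / 4 + 3 / 4 * a) * (8 * (1 - ε) ^ 2 * (1 - a + a * ε)) -
      (3 - 4 * ε) * (1 + ε) * (1 / 2 + a * ε) ^ 2 := by
  have k0 : 0 ≤ 5 / 4 - 15 / 4 * ε + 3 * ε ^ 2 := by
    nlinarith [sq_nonneg (ε - 5 / 8)]
  have k1 : 0 ≤ 9 / 4 - 6 * ε + 13 / 4 * ε ^ 2 + 3 / 2 * ε ^ 3 := by
    nlinarith [sq_nonneg (ε - 16 / 25), mul_nonneg h0 (sq_nonneg (ε - 16 / 25))]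
  have k2 : 0 ≤ 7 / 4 - 15 / 4 * ε - 7 / 4 * ε ^ 2 + 19 / 4 * ε ^ 3 + 1 * ε ^ 4 := by
    nlinarith [sq_nonneg (ε - 59 / 100), sq_nonneg (ε * (ε - 59 / 100)),
      mul_nonneg h0 (sq_nonneg (ε - 59 / 100))]
  have := quadratic_nonneg_of_coeffs ha ha' k0 k1 k2
  linarith

lemma tangential_coeff_cross {ε a : ℝ} (h0 : 0 ≤ ε) (h1 : 0 ≤ 3 / 4 - ε) (ha : 0 ≤ a)
    (ha' : a ≤ 1 / 2) :
    0 ≤ 11 / 20 * (8 * (1 - ε) ^ 2 * (1 - a + a * ε)) * (1 + ε) * (3 - 4 * ε) +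
      6 * a * (1 - ε) * (1 - a + 4 * (1 - ε) * (a * ε)) * (1 + ε / 2) -
      2 * (3 - 4 * ε) ^ 2 * (1 / 2 + a * ε) * (1 / 2 + 2 * (a * ε)) * (1 + ε) * (1 + ε / 2) := by
  have k0 : 0 ≤ 87 / 10 - 511 / 20 * ε + 243 / 20 * ε ^ 2 + 124 / 5 * ε ^ 3 - 108 / 5 * ε ^ 4 := by
    have e : 0 ≤ 29 / 10 - 93 / 20 * ε - 43 / 20 * ε ^ 2 + 27 / 5 * ε ^ 3 := by
      nlinarith [mul_nonneg h0 (sq_nonneg (ε - 3 / 5)), sq_nonneg (ε - 3 / 5)]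
    linarith [mul_nonneg (by linarith : 0 ≤ 3 - 4 * ε) e]
  have k1 : 0 ≤ 69 / 10 - 441 / 20 * ε + 419 / 40 * ε ^ 2 + 1193 / 40 * ε ^ 3 -
      37 / 2 * ε ^ 4 - 52 / 5 * ε ^ 5 := by
    nlinarith [mul_nonneg h0 h1, mul_nonneg h0 (sq_nonneg (ε - 1/2)), mul_nonneg (sq_nonneg ε) h1]
  have k2 : 0 ≤ 18 / 5 - 59 / 5 * ε - 169 / 20 * ε ^ 2 + 907 / 20 * ε ^ 3 +
      31 / 10 * ε ^ 4 - 164 / 5 * ε ^ 5 - 8 * ε ^ 6 := by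
    nlinarith [sq_nonneg (ε - 41 / 100), mul_nonneg h1 (sq_nonneg (ε - 41 / 100)),
      mul_nonneg (mul_nonneg h0 h1) (sq_nonneg (ε - 41 / 100)),
      mul_nonneg (mul_nonneg (mul_nonneg h0 h0) h1) (sq_nonneg (ε - 41 / 100)),
      mul_nonneg (mul_nonneg (pow_nonneg h0 3) h1) (sq_nonneg (ε - 41 / 100)), mul_nonneg h0 h1]
  have := quadratic_nonneg_of_coeffs ha ha' k0 k1 k2
  linarith

lemma tangential_coeff_sq_right {ε a : ℝ} (h0 : 0 ≤ ε) (h1 : 0 ≤ 3 / 4 - ε) (ha : 0 ≤ a)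
    (ha' : a ≤ 1 / 2) :
    0 ≤ (1 - (1 / 4 + 3 / 4 * a) - 11 / 20) * (8 * (1 - ε) ^ 2 * (1 - a + a * ε)) * (3 - 4 * ε) +
      18 * a * (1 - a + 4 * (1 - ε) * (a * ε)) -
      (3 - 4 * ε) ^ 2 * (1 / 2 + 2 * (a * ε)) ^ 2 := by
  have k0 : 0 ≤ 51 / 20 - 10 * ε + 68 / 5 * ε ^ 2 - 32 / 5 * ε ^ 3 := by
    have e : 0 ≤ 17 / 20 - 11 / 5 * ε + 8 / 5 * ε ^ 2 := by nlinarith [sq_nonneg (ε - 11 / 16)]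
    linarith [mul_nonneg (by linarith : 0 ≤ 3 - 4 * ε) e]
  have k1 : 0 ≤ 27 / 20 + 57 / 10 * ε + 7 / 10 * ε ^ 2 - 12 / 5 * ε ^ 3 - 8 / 5 * ε ^ 4 := by
    nlinarith [mul_nonneg h0 h1, pow_nonneg h0 3, pow_nonneg h0 4]
  have k2 : 0 ≤ 3 / 20 + 199 / 10 * ε - 77 / 10 * ε ^ 2 + 31 / 10 * ε ^ 3 - 66 / 5 * ε ^ 4 := by
    nlinarith [mul_nonneg h0 h1]
  have := quadratic_nonneg_of_coeffs ha ha' k0 k1 k2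
  linarith

lemma max_sq_ge {L L' α β : ℝ} (hL : 0 ≤ L) (hL' : 0 ≤ L') (hα : 0 ≤ α) (hβ : 0 ≤ β)
    (hαβ : 2 * α + β ≤ 2) :
    α * L ^ 2 + β * (L * L') + (1 - α - β) * L' ^ 2 ≤ max L L' ^ 2 := by
  rcases le_total L L' with h | h
  · rw [max_eq_right h]
    nlinarith [mul_nonneg hα (by nlinarith : 0 ≤ L' ^ 2 - L ^ 2),
      mul_nonneg hβ (by nlinarith : 0 ≤ L' ^ 2 - L * L')]
  · rw [max_eq_left h]
    have e : L ^ 2 - (α * L ^ 2 + β * (L * L') + (1 - α - β) * L' ^ 2) =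
        (L - L') * ((1 - α) * (L - L') + (2 - 2 * α - β) * L') := by ring
    have : 0 ≤ (L - L') * ((1 - α) * (L - L') + (2 - 2 * α - β) * L') :=
      mul_nonneg (by linarith) (add_nonneg (mul_nonneg (by linarith) (by linarith))
        (mul_nonneg (by linarith) hL'))
    linarith

lemma tangential_discriminant {ε a s L L' M μ lam : ℝ} (hε0 : 0 ≤ ε) (hε1 : ε < 3 / 4)
    (ha : 0 ≤ a) (ha' : a ≤ 1 / 2) (hs : 0 ≤ s) (hs2 : s ^ 2 = 1 + ε) (hL : 0 ≤ L)
    (hL' : 0 ≤ L') (hM0 : 0 ≤ M) (hM : (1 + ε) * max L L' ^ 2 ≤ lam * M)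
    (hlam : a * μ ≤ (1 - ε) * lam)
    (hμ : (3 - 4 * ε) * μ = 4 * (M + (L * (1 - ε) / 2 + 3 / 2 * s * L'))) :
    (1 + ε) * (3 - 4 * ε) * (s * (1 / 2 + a * ε) * L + (1 / 2 + 2 * (a * ε)) * L') ^ 2 ≤
      2 * (1 - ε) * lam * (4 * (1 - ε) * (1 - a + a * ε) * M +
        3 / 2 * s * L' * (1 - a + 4 * (1 - ε) * (a * ε))) := by
  have hε2 : 0 ≤ 3 / 4 - ε := by linarith
  have F1 := tangential_coeff_sq_left hε0 hε2 ha ha'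
  have F2 := tangential_coeff_cross hε0 hε2 ha ha'
  have F3 := tangential_coeff_sq_right hε0 hε2 ha ha'
  have hmax := max_sq_ge (α := 1 / 4 + 3 / 4 * a) (β := 11 / 20) hL hL' (by positivity)
    (by norm_num) (by linarith)
  have hs1 : s ≤ 1 + ε / 2 := by nlinarith
  have h1ε : 0 ≤ 1 - ε := by linarith
  have hD : 0 < 3 - 4 * ε := by linarith
  have haε : 0 ≤ a * ε := by positivity
  have hT : 0 ≤ 8 * (1 - ε) ^ 2 * (1 - a + a * ε) :=
    mul_nonneg (by positivity) (by linarith)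
  have hv : 0 ≤ 1 - a + 4 * (1 - ε) * (a * ε) :=
    add_nonneg (by linarith) (by positivity)
  generalize hTe : 8 * (1 - ε) ^ 2 * (1 - a + a * ε) = T at F1 F2 F3 hT
  generalize 1 - a + 4 * (1 - ε) * (a * ε) = v at F1 F2 F3 hv ⊢
  generalize 1 / 2 + 2 * (a * ε) = c2 at F1 F2 F3 hv ⊢
  generalize 1 / 2 + a * ε = c1 at F1 F2 F3 hv ⊢
  have G2 : 0 ≤ 11 / 20 * T * (1 + ε) * (3 - 4 * ε) + 6 * a * (1 - ε) * v * s -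
      2 * (3 - 4 * ε) ^ 2 * c1 * c2 * (1 + ε) * s := by
    have k1 := mul_nonneg hs F2
    have k2 : 0 ≤ (1 + ε / 2 - s) * (11 / 20 * T * (1 + ε) * (3 - 4 * ε)) :=
      mul_nonneg (by linarith) (by positivity)
    refine (mul_nonneg_iff_of_pos_left (by positivity : 0 < 1 + ε / 2)).1 ?_
    linarith
  have R1 : T * ((1 + ε) * max L L' ^ 2) ≤ T * (lam * M) := mul_le_mul_of_nonneg_left hM hT
  have R2 : 4 * a * (L * (1 - ε) / 2 + 3 / 2 * s * L') ≤ (3 - 4 * ε) * ((1 - ε) * lam) := by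
    have k1 := mul_le_mul_of_nonneg_left hlam hD.le
    have k2 : (3 - 4 * ε) * (a * μ) = a * ((3 - 4 * ε) * μ) := by ring
    rw [k2, hμ] at k1
    have := mul_nonneg ha hM0
    linarith
  have R3 := mul_le_mul_of_nonneg_right R2 (by positivity : 0 ≤ 3 * s * L' * v)
  have H1 := mul_nonneg F1 (by positivity : 0 ≤ (1 + ε) * (3 - 4 * ε) * L ^ 2)
  have H2 := mul_nonneg G2 (by positivity : 0 ≤ L * L')
  have H3 := mul_nonneg F3 (by positivity : 0 ≤ (1 + ε) * L' ^ 2)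
  have H4 := mul_le_mul_of_nonneg_left hmax (by positivity : 0 ≤ T * (1 + ε) * (3 - 4 * ε))
  have R1' := mul_le_mul_of_nonneg_left R1 hD.le
  refine le_of_mul_le_mul_left ?_ hD
  have e1 : (3 - 4 * ε) * ((1 + ε) * (3 - 4 * ε) * (s * c1 * L + c2 * L') ^ 2) =
      (3 - 4 * ε) ^ 2 * (1 + ε) * ((1 + ε) * c1 ^ 2 * L ^ 2 + 2 * s * c1 * c2 * (L * L') +
        c2 ^ 2 * L' ^ 2) := by
    rw [← hs2]; ring
  have e2 : (3 - 4 * ε) * (2 * (1 - ε) * lam * (4 * (1 - ε) * (1 - a + a * ε) * M +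
      3 / 2 * s * L' * v)) = (3 - 4 * ε) * (T * (lam * M)) +
      (3 - 4 * ε) * ((1 - ε) * lam) * (3 * s * L' * v) := by
    rw [← hTe]; ring
  have e3 : 4 * a * (L * (1 - ε) / 2 + 3 / 2 * s * L') * (3 * s * L' * v) =
      6 * a * (1 - ε) * v * s * (L * L') + 18 * a * v * ((1 + ε) * L' ^ 2) := by
    rw [← hs2]; ring
  rw [e1, e2]
  rw [e3] at R3
  linarith

section merit

variable {n p : ℕ} {ε L L' Lm μ M lam γ a : ℝ} {f m : Matrix (Fin n) (Fin p) ℝ → ℝ}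
  {gradf gradm : Matrix (Fin n) (Fin p) ℝ → Matrix (Fin n) (Fin p) ℝ}
  {X : Matrix (Fin n) (Fin p) ℝ}

lemma IsLandingMerit.finner_gradm_normalStep_ge
    (h : IsLandingMerit ε L L' Lm μ f gradf m gradm) (hε1 : ε ≤ 3 / 4) (hL : 0 ≤ L)
    (hL' : 0 ≤ L') (ha : 0 ≤ a) (ha' : a ≤ 1 / 2) (hX : fnorm (Xᵀ * X - 1) ≤ ε) :
    fnorm (skewPart (gradf X * Xᵀ) * X) ^ 2 / (1 + ε) -
      (Real.sqrt (1 + ε) * (1 / 2 + a * ε) * L + (1 / 2 + 2 * (a * ε)) * L') *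
        fnorm (Xᵀ * X - 1) * fnorm (skewPart (gradf X * Xᵀ) * X) ≤
      finner (gradm (normalStep a X)) (skewPart (gradf X * Xᵀ) * X) := by
  have hε0 : 0 ≤ ε := (fnorm_nonneg _).trans hX
  have hX' := gram_normalStep_le hε1 ha ha' hX
  have hB := transpose_mul_skewPart_mul (X := X) (gradf X)
  have h1 := fnorm_skewPart_mul_sq_le (gradf X) hX
  have h2 := h.abs_finner_gradf_sub_le X (X * (Xᵀ * X - 1)) (skewPart (gradf X * Xᵀ) * X) ha
    fun t ht => gram_normalStep_le hε1 ht.1 (ht.2.trans ha') hX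
  change |finner (gradf (normalStep a X) - gradf X) _| ≤ _ at h2
  have h3 := fnorm_mul_le_sqrt hX (Xᵀ * X - 1)
  have h4 := fnorm_gram_normalStep_le hε1 ha ha' hX
  have h5 := fnorm_mul_le_sqrt hX' ((normalStep a X)ᵀ * normalStep a X - 1)
  have h6 := h.gradf_le _ hX'
  have h7 := h.hess_le _ hX' (skewPart (gradf X * Xᵀ) * X)
  have hC := fnorm_commutator_le hX (skewPart (gradf X * Xᵀ) * X)
  rw [h.finner_gradm, normalStep_cross hB, finner_normalStep_mul_gram hB]
  set B := skewPart (gradf X * Xᵀ) * X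
  set C := (Xᵀ * X - 1) * (Xᵀ * B) - Xᵀ * B * (Xᵀ * X - 1)
  have hCX := fnorm_mul_le_sqrt hX' C
  set Y := normalStep a X
  have hs2 := Real.mul_self_sqrt (by linarith : 0 ≤ 1 + ε)
  have hs := Real.sqrt_nonneg (1 + ε)
  set s := Real.sqrt (1 + ε)
  have hr : 0 ≤ 1 - 2 * a * (1 - ε) := by nlinarith
  set r := 1 - 2 * a * (1 - ε) with hr_def
  have hz := fnorm_nonneg B
  have hd := fnorm_nonneg (Xᵀ * X - 1)
  set d := fnorm (Xᵀ * X - 1)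
  set z := fnorm B
  have t1 : z ^ 2 / (1 + ε) - L * a * (s * d) * z ≤ finner (gradf Y) B := by
    rw [finner_sub_left] at h2
    have k1 : z ^ 2 / (1 + ε) ≤ finner (gradf X) B := by
      rw [div_le_iff₀ (by linarith)]
      linarith
    have k2 : L * a * fnorm (X * (Xᵀ * X - 1)) * z ≤ L * a * (s * d) * z := by gcongr
    linarith [(abs_le.1 h2).1]
  have t2 : finner (fderiv ℝ gradf Y B) (Y * (Yᵀ * Y - 1)) ≤ L * z * (s * (r * d)) :=
    (finner_le _ _).trans (mul_le_mul h7 (h5.trans (mul_le_mul_of_nonneg_left h4 hs))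
      (fnorm_nonneg _) (mul_nonneg hL hz))
  have t3 : finner (gradf Y) (B * (Yᵀ * Y - 1)) ≤ L' * (z * (r * d)) :=
    (finner_le _ _).trans (mul_le_mul h6
      ((fnorm_mul_le _ _).trans (mul_le_mul_of_nonneg_left h4 hz)) (fnorm_nonneg _) hL')
  have t4 : -(finner (gradf Y) (Y * C)) ≤ L' * (s * (2 * s * d * z)) := by
    refine (neg_le_abs _).trans ((abs_finner_le _ _).trans ?_)
    exact mul_le_mul h6 (hCX.trans (mul_le_mul_of_nonneg_left hC hs)) (fnorm_nonneg _) hL'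
  have t4' : L' * (s * (2 * s * d * z)) = 2 * (1 + ε) * L' * d * z := by
    rw [← hs2]; ring
  rw [t4'] at t4
  have t5 := mul_le_mul_of_nonneg_left t4 ha
  rw [finner_add_right, Matrix.mul_neg, Matrix.mul_smul, finner_neg_right, finner_smul_right]
  have t6 : L * z * (s * (r * d)) = L * z * s * d * r := by ring
  have t7 : L' * (z * (r * d)) = L' * z * d * r := by ring
  rw [t6, hr_def] at t2
  rw [t7, hr_def] at t3
  linarith

lemma IsLandingMerit.normalStep_decrease_ge
    (h : IsLandingMerit ε L L' Lm μ f gradf m gradm) (hε1 : ε < 3 / 4) (hL : 0 ≤ L)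
    (hL' : 0 ≤ L') (hM : 0 ≤ M)
    (hμ : (3 - 4 * ε) * μ = 4 * (M + (L * (1 - ε) / 2 + 3 / 2 * Real.sqrt (1 + ε) * L')))
    (ha : 0 ≤ a) (ha' : a ≤ 1 / 2) (hX : fnorm (Xᵀ * X - 1) ≤ ε) :
    a * (4 * (1 - ε) * (1 - a + a * ε) * M + 3 / 2 * Real.sqrt (1 + ε) * L' *
      (1 - a + 4 * (1 - ε) * (a * ε))) * fnorm (Xᵀ * X - 1) ^ 2 ≤
      (3 - 4 * ε) * (m X - m (normalStep a X)) := by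
  have h1 := h.normalStep_decrease hε1.le ha ha' hX
  have h2 := penaltyN_sub_normalStep_ge' hε1.le ha ha' hX
  have h3 := penaltyN_sub_normalStep_ge_gram hε1.le ha ha' hX
  set D := penaltyN X - penaltyN (normalStep a X)
  set d2 := fnorm (Xᵀ * X - 1) ^ 2
  set q := fnorm (X * (Xᵀ * X - 1)) ^ 2
  have hs := Real.sqrt_nonneg (1 + ε)
  set s := Real.sqrt (1 + ε)
  have h4 := mul_le_mul_of_nonneg_left h1 (by linarith : 0 ≤ 3 - 4 * ε)
  have e1 : (3 - 4 * ε) * (μ * D) = D * ((3 - 4 * ε) * μ) := by ring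
  have h5 := mul_le_mul_of_nonneg_left h3 (by positivity : 0 ≤ 4 * (M + 3 / 2 * s * L'))
  have h6 := mul_le_mul_of_nonneg_left h2 (by positivity : 0 ≤ L / 2)
  have h7 : (3 - 4 * ε) * (μ * D) =
      D * (4 * (M + (L * (1 - ε) / 2 + 3 / 2 * s * L'))) := by rw [e1, hμ]
  linarith

/-- Sufficient decrease of the merit function along one landing step. -/
lemma IsLandingMerit.landing_decrease
    (h : IsLandingMerit ε L L' Lm μ f gradf m gradm) (hε1 : ε < 3 / 4) (hL : 0 ≤ L)
    (hL' : 0 ≤ L') (hM0 : 0 ≤ M) (hM : (1 + ε) * max L L' ^ 2 ≤ lam * M)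
    (hμ : (3 - 4 * ε) * μ = 4 * (M + (L * (1 - ε) / 2 + 3 / 2 * Real.sqrt (1 + ε) * L')))
    (hγ : 0 ≤ γ) (hlam : 0 ≤ lam) (ha' : γ * lam ≤ 1 / 2) (hγLm : γ * Lm ≤ 1 / 2)
    (haμ : γ * lam * μ ≤ (1 - ε) * lam) (hX : fnorm (Xᵀ * X - 1) ≤ ε) :
    1 / 4 * γ * fnorm (skewPart (gradf X * Xᵀ) * X) ^ 2 ≤
      m X - m (normalStep (γ * lam) X - γ • (skewPart (gradf X * Xᵀ) * X)) := by
  have hε0 : 0 ≤ ε := (fnorm_nonneg _).trans hX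
  have ha : 0 ≤ γ * lam := by positivity
  have hs := Real.sqrt_nonneg (1 + ε)
  have h1 := h.finner_gradm_normalStep_ge hε1.le hL hL' ha ha' hX
  have h2 := h.normalStep_decrease_ge hε1 hL hL' hM0 hμ ha ha' hX
  have h3 := tangential_discriminant hε0 hε1 ha ha' hs (Real.sq_sqrt (by linarith)) hL hL' hM0 hM
    haμ hμ
  have h4 := h.descent (normalStep (γ * lam) X) (-(γ • (skewPart (gradf X * Xᵀ) * X)))
  rw [← sub_eq_add_neg, finner_neg_right, finner_smul_right, fnorm_neg, fnorm_smul,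
    abs_of_nonneg hγ] at h4
  generalize skewPart (gradf X * Xᵀ) * X = B at *
  generalize 4 * (1 - ε) * (1 - γ * lam + γ * lam * ε) * M + 3 / 2 * Real.sqrt (1 + ε) * L' *
      (1 - γ * lam + 4 * (1 - ε) * (γ * lam * ε)) = k at *
  generalize Real.sqrt (1 + ε) * (1 / 2 + γ * lam * ε) * L + (1 / 2 + 2 * (γ * lam * ε)) * L' = b
    at *
  generalize normalStep (γ * lam) X = Y at *
  generalize fnorm (Xᵀ * X - 1) = d at *
  generalize fnorm B = z at *
  have hD : 0 < 3 - 4 * ε := by linarith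
  have h1' := mul_le_mul_of_nonneg_left h1 hγ
  have h5 : Lm / 2 * (γ * z) ^ 2 ≤ 1 / 4 * γ * z ^ 2 := by
    have := mul_le_mul_of_nonneg_right hγLm (by positivity : 0 ≤ γ * z ^ 2 / 2)
    linarith
  have h6 : γ * lam * k * d ^ 2 / (3 - 4 * ε) ≤ m X - m Y := by
    rw [div_le_iff₀ hD]
    linarith
  have h7 : 0 ≤ z ^ 2 / (1 + ε) - z ^ 2 / 2 - b * d * z + lam * k * d ^ 2 / (3 - 4 * ε) := by
    have hpos : 0 < 1 + ε := by linarith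
    have h1ε : 0 < 1 - ε := by linarith
    have e1 : z ^ 2 / (1 + ε) - z ^ 2 / 2 - b * d * z + lam * k * d ^ 2 / (3 - 4 * ε) =
        ((1 - ε) * z - (1 + ε) * b * d) ^ 2 / (2 * (1 + ε) * (1 - ε)) +
        (2 * (1 - ε) * lam * k - (1 + ε) * (3 - 4 * ε) * b ^ 2) * d ^ 2 /
          (2 * (1 - ε) * (3 - 4 * ε)) := by
      generalize 3 - 4 * ε = D at hD ⊢
      have hne := h1ε.ne'
      field_simp
      ring
    rw [e1]
    have : 0 ≤ 2 * (1 - ε) * lam * k - (1 + ε) * (3 - 4 * ε) * b ^ 2 := by linarith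
    positivity
  have h8 := mul_nonneg hγ h7
  have e2 : γ * (z ^ 2 / (1 + ε) - z ^ 2 / 2 - b * d * z + lam * k * d ^ 2 / (3 - 4 * ε)) =
      γ * (z ^ 2 / (1 + ε) - b * d * z) - γ * z ^ 2 / 2 + γ * lam * k * d ^ 2 / (3 - 4 * ε) := by
    ring
  rw [e2] at h8
  linarith

end merit

section parameters

lemma landing_merit_margin {ε lam s L L' μ : ℝ} (hε1 : ε < 3 / 4) (hlam : 0 < lam)
    (hμ : (2 / (3 - 4 * ε)) *
      (L * (1 - ε) + 3 * s * L' + 2 * max L L' ^ 2 * (1 + ε) / lam) ≤ μ) :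
    (1 + ε) * max L L' ^ 2 ≤
      lam * ((3 - 4 * ε) * μ / 4 - (L * (1 - ε) / 2 + 3 / 2 * s * L')) := by
  have hD : 0 < 3 - 4 * ε := by linarith
  rw [div_mul_eq_mul_div, div_le_iff₀ hD] at hμ
  have h1 : max L L' ^ 2 * (1 + ε) / lam ≤
      (3 - 4 * ε) * μ / 4 - (L * (1 - ε) / 2 + 3 / 2 * s * L') := by
    have : 2 * max L L' ^ 2 * (1 + ε) / lam = 2 * (max L L' ^ 2 * (1 + ε) / lam) := by ring
    linarith
  rw [div_le_iff₀ hlam] at h1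
  linarith

/-- The part of `μ` that lower bounds the Lipschitz constant of the merit gradient. -/
lemma landing_merit_excess {ε s L L' μ M : ℝ} (hε0 : 0 ≤ ε) (hs : 1 ≤ s)
    (hL' : 0 ≤ L') (hM : 0 ≤ M)
    (hμ : (3 - 4 * ε) * μ = 4 * (M + (L * (1 - ε) / 2 + 3 / 2 * s * L'))) :
    μ ≤ 4 * (1 - ε) * (μ - L / 2 - 3 / 2 * L') := by
  have h1 : L' ≤ s * L' := le_mul_of_one_le_left hL' hs
  have h2 : 0 ≤ ε * L' := by positivity
  linarith

end parameters

section iterates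

variable {n p : ℕ}

lemma sub_smul_landingDir (γ lam : ℝ) (X g : Matrix (Fin n) (Fin p) ℝ) :
    X - γ • landingDir lam X g = normalStep (γ * lam) X - γ • (skewPart (g * Xᵀ) * X) := by
  rw [landingDir, normalStep, smul_add, smul_smul]
  abel

lemma fnorm_eq_zero_of_isEmpty (A : Matrix (Fin n) (Fin 0) ℝ) : fnorm A = 0 := by
  simp [fnorm, Matrix.trace]

lemma sum_range_le_of_descent {m z : ℕ → ℝ} {c mstar : ℝ} (h : ∀ k, c * z k ≤ m k - m (k + 1))
    (hm : ∀ k, mstar ≤ m k) (K : ℕ) : c * ∑ k ∈ Finset.range K, z k ≤ m 0 - mstar := by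
  calc c * ∑ k ∈ Finset.range K, z k = ∑ k ∈ Finset.range K, c * z k := Finset.mul_sum _ _ _
    _ ≤ ∑ k ∈ Finset.range K, (m k - m (k + 1)) := Finset.sum_le_sum fun k _ => h k
    _ = m 0 - m K := Finset.sum_range_sub' m K
    _ ≤ m 0 - mstar := by linarith [hm K]

lemma sum_range_le_of_contraction {u w : ℕ → ℝ} {r : ℝ} (hu : ∀ k, 0 ≤ u k)
    (h : ∀ k, u (k + 1) ≤ r ^ 2 * u k + r * w k) (K : ℕ) :
    (1 - r ^ 2) * ∑ k ∈ Finset.range K, u k ≤ u 0 + r * ∑ k ∈ Finset.range K, w k := by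
  have h1 : ∑ k ∈ Finset.range K, u (k + 1) ≤
      r ^ 2 * ∑ k ∈ Finset.range K, u k + r * ∑ k ∈ Finset.range K, w k := by
    rw [Finset.mul_sum, Finset.mul_sum, ← Finset.sum_add_distrib]
    exact Finset.sum_le_sum fun k _ => h k
  have h2 := Finset.sum_range_succ u K
  rw [Finset.sum_range_succ'] at h2
  linarith [hu K]

lemma penaltyN_nonneg (X : Matrix (Fin n) (Fin p) ℝ) : 0 ≤ penaltyN X := by
  rw [penaltyN]
  positivity

lemma average_le {S A c K : ℝ} (hK : 0 < K) (hc : 0 < c) (h : c * S ≤ A) :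
    1 / K * S ≤ A / (K * c) := by
  rw [le_div_iff₀ (by positivity)]
  calc 1 / K * S * (K * c) = c * S := by field_simp
    _ ≤ A := h

lemma landing_step_sq_le {ε lam γ L' z : ℝ} (hγ0 : 0 ≤ γ) (hz : 0 ≤ z)
    (hzL : z ≤ (1 + ε) * L')
    (hγs : γ * ((1 + ε) ^ 2 * L' ^ 2 + lam ^ 2 * (1 + ε) * ε ^ 2) ≤ lam * (1 - ε) * ε) :
    γ ^ 2 * z ^ 2 + (γ * lam) ^ 2 * (1 + ε) * ε ^ 2 ≤ γ * lam * ε * (1 - ε) := by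
  have h1 := mul_le_mul_of_nonneg_left hγs hγ0
  have h2 : γ ^ 2 * z ^ 2 ≤ γ ^ 2 * ((1 + ε) * L') ^ 2 := by gcongr
  linarith

/-- Iterates of the landing method whose step size is small compared to the penalty parameter. -/
lemma IsLandingMerit.landing_averages {ε L L' Lm μ M lam γ mstar : ℝ}
    {f : Matrix (Fin n) (Fin p) ℝ → ℝ}
    {gradf : Matrix (Fin n) (Fin p) ℝ → Matrix (Fin n) (Fin p) ℝ}
    {m : Matrix (Fin n) (Fin p) ℝ → ℝ}
    {gradm : Matrix (Fin n) (Fin p) ℝ → Matrix (Fin n) (Fin p) ℝ}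
    (h : IsLandingMerit ε L L' Lm μ f gradf m gradm) (hε0 : 0 < ε) (hε1 : ε < 3 / 4)
    (hL : 0 < L) (hL' : 0 < L') (hM0 : 0 < M) (hM : (1 + ε) * max L L' ^ 2 ≤ lam * M)
    (hμ : (3 - 4 * ε) * μ = 4 * (M + (L * (1 - ε) / 2 + 3 / 2 * Real.sqrt (1 + ε) * L')))
    (hlam : 0 < lam) (hγ0 : 0 < γ) (ha' : γ * lam ≤ 1 / 2) (hγLm : γ * Lm ≤ 1 / 2)
    (hγs : γ * ((1 + ε) ^ 2 * L' ^ 2 + lam ^ 2 * (1 + ε) * ε ^ 2) ≤ lam * (1 - ε) * ε)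
    (hmlb : ∀ X : Matrix (Fin n) (Fin p) ℝ, fnorm (Xᵀ * X - 1) ≤ ε → mstar ≤ m X)
    {X : ℕ → Matrix (Fin n) (Fin p) ℝ} (hX : ∀ k, fnorm ((X k)ᵀ * X k - 1) ≤ ε)
    (hrec : ∀ k, X (k + 1) = X k - γ • landingDir lam (X k) (gradf (X k)))
    (hγμ : γ * μ ≤ 1 - ε) (K : ℕ) :
    γ / 4 * ∑ k ∈ Finset.range K, fnorm (skewPart (gradf (X k) * (X k)ᵀ) * X k) ^ 2 ≤
        m (X 0) - mstar ∧
      γ * lam * μ * ∑ k ∈ Finset.range K, penaltyN (X k) ≤ 2 * (m (X 0) - mstar) := by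
  set z : ℕ → ℝ := fun k => fnorm (skewPart (gradf (X k) * (X k)ᵀ) * X k) with hz
  have ha : 0 < γ * lam := by positivity
  have hμ0 : 0 < μ := by
    have h1 : 0 ≤ L * (1 - ε) := mul_nonneg hL.le (by linarith)
    have h2 : 0 ≤ Real.sqrt (1 + ε) * L' := by positivity
    have h3 : 0 < (3 - 4 * ε) * μ := by linarith
    exact pos_of_mul_pos_right h3 (by linarith)
  have haε : γ * lam * ε * (1 + ε) ≤ 1 - ε := by
    have h1 : 0 ≤ γ * ((1 + ε) ^ 2 * L' ^ 2) := by positivity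
    refine le_of_mul_le_mul_left ?_ (mul_pos hlam hε0)
    linarith
  have hzL (k) : z k ≤ (1 + ε) * L' :=
    (fnorm_skewPart_mul_le (gradf (X k)) (hX k)).trans
      (mul_le_mul_of_nonneg_left (h.gradf_le _ (hX k)) (by linarith))
  have hdesc (k) : γ / 4 * z k ^ 2 ≤ m (X k) - m (X (k + 1)) := by
    have h1 := h.landing_decrease hε1 hL.le hL'.le hM0.le hM hμ hγ0.le hlam.le ha' hγLm
      (by linarith [mul_le_mul_of_nonneg_right hγμ hlam.le]) (hX k)
    rw [← sub_smul_landingDir, ← hrec] at h1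
    linarith
  have hgradient := sum_range_le_of_descent hdesc (fun k => hmlb _ (hX k)) K
  refine ⟨hgradient, ?_⟩
  have hcontr (k) : penaltyN (X (k + 1)) ≤ (1 - 2 * (γ * lam) * (1 - ε)) ^ 2 * penaltyN (X k) +
      (1 - 2 * (γ * lam) * (1 - ε)) * (γ ^ 2 * z k ^ 2) := by
    rw [hrec, sub_smul_landingDir]
    exact penaltyN_normalStep_sub_le (transpose_mul_skewPart_mul _) (hX k) hε1.le ha.le ha' hγ0.le
      (landing_step_sq_le hγ0.le (fnorm_nonneg _) (hzL k) hγs) haε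
  have h1 := sum_range_le_of_contraction (fun k => penaltyN_nonneg (X k)) hcontr K
  rw [← Finset.mul_sum] at h1
  have h2 := h.merit_ge_add_penalty hε1.le hL hL'.le hμ hM0 hmlb (hX 0)
  have hε' : 0 < 1 - ε := by linarith
  have hS : 0 ≤ ∑ k ∈ Finset.range K, z k ^ 2 := by positivity
  have hr : 0 < 1 - 2 * (γ * lam) * (1 - ε) := by
    have := mul_le_mul_of_nonneg_right ha' hε'.le
    linarith
  generalize ∑ k ∈ Finset.range K, z k ^ 2 = S at *
  generalize ∑ k ∈ Finset.range K, penaltyN (X k) = T at *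
  have h3 : μ * penaltyN (X 0) ≤ 4 * (1 - ε) * (m (X 0) - mstar) := by
    have h4 : μ / (4 * (1 - ε)) * penaltyN (X 0) ≤ m (X 0) - mstar := by linarith
    rwa [div_mul_eq_mul_div, div_le_iff₀ (by positivity), mul_comm (m (X 0) - mstar)] at h4
  have h5 : μ * (γ ^ 2 * S) ≤ 4 * (1 - ε) * (m (X 0) - mstar) := by
    have e1 := mul_le_mul_of_nonneg_right hγμ (mul_nonneg hγ0.le hS)
    have e2 := mul_le_mul_of_nonneg_left hgradient hε'.le
    linarith
  have h6 := mul_le_mul_of_nonneg_left h1 hμ0.le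
  have h7 := mul_le_mul_of_nonneg_left h5 hr.le
  refine le_of_mul_le_mul_left ?_
    (mul_pos (by linarith : 0 < 1 + (1 - 2 * (γ * lam) * (1 - ε))) (mul_pos two_pos hε'))
  linarith

lemma IsLandingMerit.landing_gram_le {ε L L' Lm μ lam γ : ℝ}
    {f : Matrix (Fin n) (Fin p) ℝ → ℝ}
    {gradf : Matrix (Fin n) (Fin p) ℝ → Matrix (Fin n) (Fin p) ℝ}
    {m : Matrix (Fin n) (Fin p) ℝ → ℝ}
    {gradm : Matrix (Fin n) (Fin p) ℝ → Matrix (Fin n) (Fin p) ℝ}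
    (h : IsLandingMerit ε L L' Lm μ f gradf m gradm) (hε0 : 0 < ε) (hε1 : ε < 3 / 4)
    (hlam : 0 < lam) (hγ0 : 0 < γ) (ha' : γ * lam ≤ 1 / 2)
    (hγs : γ * ((1 + ε) ^ 2 * L' ^ 2 + lam ^ 2 * (1 + ε) * ε ^ 2) ≤ lam * (1 - ε) * ε)
    {X : Matrix (Fin n) (Fin p) ℝ} (hX : fnorm (Xᵀ * X - 1) ≤ ε) :
    fnorm ((X - γ • landingDir lam X (gradf X))ᵀ * (X - γ • landingDir lam X (gradf X)) - 1) ≤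
      ε := by
  have ha : 0 ≤ γ * lam := by positivity
  have h1 := landing_step_sq_le hγ0.le (fnorm_nonneg _)
    ((fnorm_skewPart_mul_le (gradf X) hX).trans
      (mul_le_mul_of_nonneg_left (h.gradf_le _ hX) (by linarith))) hγs
  have h2 : 0 ≤ γ * lam * ε * (1 - ε) := mul_nonneg (by positivity) (by linarith)
  exact fnorm_gram_landing_le (transpose_mul_skewPart_mul _) hX ha ha' (by linarith)

end iterates

/-- vanilla Landing convergence in the deterministic scenario. -/
theorem vanilla_landing_deterministic {n p : ℕ} (ε lam L L' Lm μ mstar γ : ℝ)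
    (hε : ε ∈ Set.Ioo (0 : ℝ) (3 / 4)) (hlam : 0 < lam)
    (hL : 0 < L) (hL' : 0 < L') (hLm : 0 < Lm)
    (f : Matrix (Fin n) (Fin p) ℝ → ℝ)
    (gradf : Matrix (Fin n) (Fin p) ℝ → Matrix (Fin n) (Fin p) ℝ)
    (hC2 : ContDiff ℝ 2 f)
    (hgrad : ∀ Y H : Matrix (Fin n) (Fin p) ℝ, fderiv ℝ f Y H = finner (gradf Y) H)
    (hgb : ∀ X : Matrix (Fin n) (Fin p) ℝ, fnorm (Xᵀ * X - 1) ≤ ε → fnorm (gradf X) ≤ L')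
    (hhess : ∀ X : Matrix (Fin n) (Fin p) ℝ, fnorm (Xᵀ * X - 1) ≤ ε →
      ∀ H : Matrix (Fin n) (Fin p) ℝ, fnorm (fderiv ℝ gradf X H) ≤ L * fnorm H)
    (hμ : (2 / (3 - 4 * ε)) *
      (L * (1 - ε) + 3 * Real.sqrt (1 + ε) * L' + 2 * max L L' ^ 2 * (1 + ε) / lam) ≤ μ)
    (m : Matrix (Fin n) (Fin p) ℝ → ℝ)
    (hm : ∀ Y : Matrix (Fin n) (Fin p) ℝ,
      m Y = f Y - (1 / 2) * finner (symPart (Yᵀ * gradf Y)) (Yᵀ * Y - 1) + μ * penaltyN Y)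
    (gradm : Matrix (Fin n) (Fin p) ℝ → Matrix (Fin n) (Fin p) ℝ)
    (hmdiff : Differentiable ℝ m)
    (hgradm : ∀ Y H : Matrix (Fin n) (Fin p) ℝ, fderiv ℝ m Y H = finner (gradm Y) H)
    (hmlip : ∀ Y Z : Matrix (Fin n) (Fin p) ℝ,
      fnorm (gradm Y - gradm Z) ≤ Lm * fnorm (Y - Z))
    (hmlb : ∀ X : Matrix (Fin n) (Fin p) ℝ, fnorm (Xᵀ * X - 1) ≤ ε → mstar ≤ m X)
    (hγ0 : 0 < γ)
    (hγ : γ ≤ min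
      (min (lam * (1 - ε) * ε / ((1 + ε) ^ 2 * L' ^ 2 + lam ^ 2 * (1 + ε) * ε ^ 2))
        (min (Real.sqrt (ε / (2 * (1 + ε) ^ 2 * L' ^ 2))) (1 / (2 * lam))))
      (min (1 / (2 * Lm)) (μ / (4 * lam ^ 2 * (1 + ε) * Lm))))
    (X : ℕ → Matrix (Fin n) (Fin p) ℝ)
    (hX0 : fnorm ((X 0)ᵀ * X 0 - 1) ≤ ε)
    (hrec : ∀ k, X (k + 1) = X k - γ • landingDir lam (X k) (gradf (X k))) :
    (∀ k, fnorm ((X k)ᵀ * X k - 1) ≤ ε) ∧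
    ∀ K : ℕ, 1 ≤ K →
      (1 / (K : ℝ)) * ∑ k ∈ Finset.range K,
          fnorm (skewPart (gradf (X k) * (X k)ᵀ) * X k) ^ 2 ≤
        4 * (m (X 0) - mstar) / ((K : ℝ) * γ) ∧
      (1 / (K : ℝ)) * ∑ k ∈ Finset.range K, penaltyN (X k) ≤
        2 * (m (X 0) - mstar) / ((K : ℝ) * γ * lam * μ) := by
  obtain ⟨hε0, hε1⟩ := hε
  have hsymm (Y : Matrix (Fin n) (Fin p) ℝ) :
      finner (symPart (Yᵀ * gradf Y)) (Yᵀ * Y - 1) = finner (gradf Y) (Y * (Yᵀ * Y - 1)) := by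
    rw [finner_symPart _ (gram_sub_one_transpose Y), finner_mul_right_left]
  have hdiff : Differentiable ℝ gradf := differentiable_of_fderiv_eq_finner hC2 hgrad
  have hdf : Differentiable ℝ f := hC2.differentiable two_ne_zero
  have h : IsLandingMerit ε L L' Lm μ f gradf m gradm :=
    ⟨hdf, hdiff, hgrad, hgb, hhess, fun Y => by rw [hm, hsymm], hmdiff, hgradm, hmlip⟩
  have hM := landing_merit_margin hε1 hlam hμ
  obtain ⟨M, hMeq⟩ : ∃ M, M = (3 - 4 * ε) * μ / 4 -
    (L * (1 - ε) / 2 + 3 / 2 * Real.sqrt (1 + ε) * L') := ⟨_, rfl⟩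
  rw [← hMeq] at hM
  have hMμ : (3 - 4 * ε) * μ = 4 * (M + (L * (1 - ε) / 2 + 3 / 2 * Real.sqrt (1 + ε) * L')) := by
    rw [hMeq]
    ring
  have hM0 : 0 < M := by
    have h1 : 0 < max L L' := lt_max_of_lt_left hL
    exact pos_of_mul_pos_right ((by positivity : 0 < (1 + ε) * max L L' ^ 2).trans_le hM) hlam.le
  have hμ0 : 0 < μ := by
    refine lt_of_lt_of_le ?_ hμ
    have h1 : 0 < 3 - 4 * ε := by linarith
    have h2 : 0 < 1 - ε := by linarith
    positivity
  simp only [le_min_iff] at hγ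
  obtain ⟨⟨hγs, -, hγlam⟩, hγLm, -⟩ := hγ
  rw [le_div_iff₀ (by positivity)] at hγs hγlam hγLm
  have ha' : γ * lam ≤ 1 / 2 := by linarith
  have hγLm' : γ * Lm ≤ 1 / 2 := by linarith
  have hX (k : ℕ) : fnorm ((X k)ᵀ * X k - 1) ≤ ε := by
    induction k with
    | zero => exact hX0
    | succ k ih =>
      rw [hrec]
      exact h.landing_gram_le hε0 hε1 hlam hγ0 ha' hγs ih
  refine ⟨hX, fun K hK => ?_⟩
  have hK0 : (0 : ℝ) < K := by exact_mod_cast hK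
  have hsum : γ / 4 * ∑ k ∈ Finset.range K, fnorm (skewPart (gradf (X k) * (X k)ᵀ) * X k) ^ 2 ≤
        m (X 0) - mstar ∧
      γ * lam * μ * ∑ k ∈ Finset.range K, penaltyN (X k) ≤ 2 * (m (X 0) - mstar) := by
    rcases Nat.eq_zero_or_pos p with rfl | hp
    · have hm0 := hmlb _ hX0
      simp only [penaltyN, fnorm_eq_zero_of_isEmpty]
      constructor <;> simp [hm0]
    · refine h.landing_averages hε0 hε1 hL hL' hM0 hM hMμ hlam hγ0 ha' hγLm' hγs hmlb hX hrec ?_ K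
      have h1 := landing_merit_excess hε0.le
        (Real.one_le_sqrt.mpr (by linarith : 1 ≤ 1 + ε)) hL'.le hM0.le hMμ
      have hε' : 0 < 1 - ε := by linarith
      have h2 : 0 ≤ μ - L / 2 - 3 / 2 * L' :=
        (pos_of_mul_pos_right (hμ0.trans_le h1) (by positivity)).le
      have h3 := h.lipschitz_ge hp hε0 (by linarith) hL'.le h2 hX0
      have h4 := mul_le_mul_of_nonneg_left h1 hγ0.le
      have h5 := mul_le_mul_of_nonneg_left (mul_le_mul_of_nonneg_left h3 hγ0.le) hε'.le
      have h6 := mul_le_mul_of_nonneg_left hγLm' hε'.le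
      linarith
  constructor
  · refine (average_le hK0 (by positivity) hsum.1).trans_eq ?_
    field_simp
  · refine (average_le hK0 (by positivity) hsum.2).trans_eq ?_
    rw [← mul_assoc, ← mul_assoc]
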